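/- arXiv:1409.4489 — 12 statements merged into one kernel-verified Lean document; each statement's English description precedes it below -/
import Mathlib

section
/- Let P1, P2 ≥ 0, let 0 ≤ h1 ≤ h1' and 0 ≤ h2 ≤ h2', and let r1, r1', r2, r2' be real numbers. If r1 + r2 ≤ (1/2)log(1 + h1²P1 + h2²P2), r1' + r2' ≤ (1/2)log(1 + h1'²P1 + h2'²P2), and r1 + r2' = (1/2)log(1 + h1²P1 + h2'²P2), then r1' + r2 ≤ (1/2)log(1 + h1'²P1 + h2²P2). -/
theorem rate_exchange_lemma
    (P1 P2 h1 h1' h2 h2' r1 r1' r2 r2' : ℝ)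
    (hP1 : 0 ≤ P1) (hP2 : 0 ≤ P2)
    (hh1 : 0 ≤ h1) (hh1' : h1 ≤ h1')
    (hh2 : 0 ≤ h2) (hh2' : h2 ≤ h2')
    (hlow : r1 + r2 ≤ (1/2) * Real.log (1 + h1^2 * P1 + h2^2 * P2))
    (hhigh : r1' + r2' ≤ (1/2) * Real.log (1 + h1'^2 * P1 + h2'^2 * P2))
    (hcross : r1 + r2' = (1/2) * Real.log (1 + h1^2 * P1 + h2'^2 * P2)) :
    r1' + r2 ≤ (1/2) * Real.log (1 + h1'^2 * P1 + h2^2 * P2) := by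
  have ha : h1^2 * P1 ≤ h1'^2 * P1 := by gcongr
  have hb : h2^2 * P2 ≤ h2'^2 * P2 := by gcongr
  have ha0 : 0 ≤ h1^2 * P1 := by positivity
  have hb0 : 0 ≤ h2^2 * P2 := by positivity
  generalize h1^2 * P1 = a at *
  generalize h1'^2 * P1 = a' at *
  generalize h2^2 * P2 = b at *
  generalize h2'^2 * P2 = b' at *
  have p1 : 0 < 1 + a + b := by linarith
  have p2 : 0 < 1 + a' + b' := by linarith
  have p3 : 0 < 1 + a + b' := by linarith
  have p4 : 0 < 1 + a' + b := by linarith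
  have key : Real.log ((1 + a + b) * (1 + a' + b')) ≤ Real.log ((1 + a + b') * (1 + a' + b)) := by
    apply Real.log_le_log (by positivity)
    nlinarith [mul_nonneg (sub_nonneg.2 ha) (sub_nonneg.2 hb)]
  rw [Real.log_mul p1.ne' p2.ne', Real.log_mul p3.ne' p4.ne'] at key
  linarith
end

section
/- Let r1_i, r2_i (0 ≤ i ≤ K−1) be given by the recursive rate allocation. Then for all 0 ≤ i, j ≤ K−1, r1_i + r2_j ≤ (1/2)log(1 + a_i²P1 + b_j²P2). -/
lemma half_log_submodular (x x' y y' : ℝ) (hx : 0 ≤ x) (hy : 0 ≤ y) (hxx : x ≤ x')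
    (hyy : y ≤ y') :
    (1/2) * Real.log (1 + x' + y') + (1/2) * Real.log (1 + x + y) ≤
      (1/2) * Real.log (1 + x' + y) + (1/2) * Real.log (1 + x + y') := by
  have h : Real.log ((1 + x' + y') * (1 + x + y)) ≤ Real.log ((1 + x' + y) * (1 + x + y')) := by
    apply Real.log_le_log
    · apply mul_pos <;> linarith
    · nlinarith [mul_nonneg (sub_nonneg.2 hxx) (sub_nonneg.2 hyy)]
  rw [Real.log_mul (by linarith) (by linarith), Real.log_mul (by linarith) (by linarith)] at h
  linarith

lemma sq_mul_chain (K : ℕ) (a : ℕ → ℝ) (P : ℝ) (hP : 0 < P) (ha0 : 0 ≤ a 0)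
    (hmono : ∀ i, i + 1 < K → a i ≤ a (i + 1)) (i j : ℕ) (hij : i ≤ j) (hj : j < K) :
    (a i)^2 * P ≤ (a j)^2 * P := by
  have hnn : ∀ n, n < K → 0 ≤ a n := by
    intro n
    induction n with
    | zero => intro _; exact ha0
    | succ n ih => intro h; exact (ih (by omega)).trans (hmono n h)
  have hle : a i ≤ a j := by
    induction j, hij using Nat.le_induction with
    | base => exact le_rfl
    | succ n hn ih => exact (ih (by omega)).trans (hmono n hj)
  have := hnn i (by omega)
  gcongr

theorem recursive_rate_allocation_sum_constraint
    (K : ℕ) (hK : 1 ≤ K) (a b : ℕ → ℝ) (P1 P2 ρ : ℝ)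
    (hP1 : 0 < P1) (hP2 : 0 < P2)
    (ha0 : 0 ≤ a 0) (hb0 : 0 ≤ b 0)
    (hamono : ∀ i, i + 1 < K → a i ≤ a (i + 1))
    (hbmono : ∀ i, i + 1 < K → b i ≤ b (i + 1))
    (hρ1 : (1/2) * Real.log (1 + (a 0)^2 * P1 / (1 + (b 0)^2 * P2)) ≤ ρ)
    (hρ2 : ρ ≤ (1/2) * Real.log (1 + (a 0)^2 * P1))
    (r1 r2 : ℕ → ℝ)
    (hr10 : r1 0 = ρ)
    (hr2 : ∀ i < K, r2 i = (1/2) * Real.log (1 + (a i)^2 * P1 + (b i)^2 * P2) - r1 i)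
    (hr1 : ∀ j, 1 ≤ j → j < K →
      r1 j = (1/2) * Real.log (1 + (a j)^2 * P1 + (b (j - 1))^2 * P2) - r2 (j - 1)) :
    ∀ i < K, ∀ j < K,
      r1 i + r2 j ≤ (1/2) * Real.log (1 + (a i)^2 * P1 + (b j)^2 * P2) := by
  have hx := sq_mul_chain K a P1 hP1 ha0 hamono
  have hy := sq_mul_chain K b P2 hP2 hb0 hbmono
  have px : ∀ i, 0 ≤ (a i)^2 * P1 := fun i => by positivity
  have py : ∀ i, 0 ≤ (b i)^2 * P2 := fun i => by positivity
  intro i hi j hj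
  rcases le_total i j with hij | hij
  · induction j, hij using Nat.le_induction with
    | base => linarith [hr2 i hi]
    | succ n hn ih =>
      have h1 := ih (by omega)
      have h2 := hr2 (n + 1) hj
      have h3 := hr1 (n + 1) (by omega) hj
      simp only [Nat.add_sub_cancel] at h3
      have h4 := half_log_submodular _ _ _ _ (px i) (py n) (hx i (n + 1) (by omega) hj)
        (hy n (n + 1) (by omega) hj)
      linarith
  · induction i, hij using Nat.le_induction with
    | base => linarith [hr2 j hj]
    | succ n hn ih =>
      have h1 := ih (by omega)
      have h2 := hr2 n (by omega)
      have h3 := hr1 (n + 1) (by omega) hi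
      simp only [Nat.add_sub_cancel] at h3
      have h4 := half_log_submodular _ _ _ _ (px n) (py j) (hx n (n + 1) (by omega) hi)
        (hy j n (by omega) (by omega))
      linarith
end

section
/- Let r1_i, r2_i (0 ≤ i ≤ K−1) be given by the recursive rate allocation. Then for all 0 ≤ i ≤ K−1, r1_i ≤ (1/2)log(1 + a_i²P1) and r2_i ≤ (1/2)log(1 + b_i²P2). -/
theorem log_submod_aux (x x' y : ℝ) (hx : 0 ≤ x) (hxx : x ≤ x') (hy : 0 ≤ y) :
    Real.log (1 + x' + y) + Real.log (1 + x) ≤ Real.log (1 + x + y) + Real.log (1 + x') := by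
  have h1 : 0 < 1 + x := by linarith
  have h2 : 0 < 1 + x' := by linarith
  have h3 : 0 < 1 + x + y := by linarith
  have h4 : 0 < 1 + x' + y := by linarith
  rw [← Real.log_mul h4.ne' h1.ne', ← Real.log_mul h3.ne' h2.ne']
  apply Real.log_le_log (by positivity)
  nlinarith [mul_le_mul_of_nonneg_left hxx hy]

theorem recursive_rate_allocation_individual_constraints
    (K : ℕ) (hK : 1 ≤ K) (a b : ℕ → ℝ) (P1 P2 ρ : ℝ)
    (hP1 : 0 < P1) (hP2 : 0 < P2)
    (ha0 : 0 ≤ a 0) (hb0 : 0 ≤ b 0)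
    (hamono : ∀ i, i + 1 < K → a i ≤ a (i + 1))
    (hbmono : ∀ i, i + 1 < K → b i ≤ b (i + 1))
    (hρ1 : (1/2) * Real.log (1 + (a 0)^2 * P1 / (1 + (b 0)^2 * P2)) ≤ ρ)
    (hρ2 : ρ ≤ (1/2) * Real.log (1 + (a 0)^2 * P1))
    (r1 r2 : ℕ → ℝ)
    (hr10 : r1 0 = ρ)
    (hr2 : ∀ i < K, r2 i = (1/2) * Real.log (1 + (a i)^2 * P1 + (b i)^2 * P2) - r1 i)
    (hr1 : ∀ j, 1 ≤ j → j < K →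
      r1 j = (1/2) * Real.log (1 + (a j)^2 * P1 + (b (j - 1))^2 * P2) - r2 (j - 1)) :
    ∀ i < K,
      r1 i ≤ (1/2) * Real.log (1 + (a i)^2 * P1) ∧
      r2 i ≤ (1/2) * Real.log (1 + (b i)^2 * P2) := by
  have hmono : ∀ i, i < K → 0 ≤ a i ∧ 0 ≤ b i := by
    intro i
    induction i with
    | zero => exact fun _ => ⟨ha0, hb0⟩
    | succ n ih =>
      intro h
      have h' := ih (by omega)
      exact ⟨h'.1.trans (hamono n h), h'.2.trans (hbmono n h)⟩
  intro i
  induction i with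
  | zero =>
    intro h
    refine ⟨by rw [hr10]; exact hρ2, ?_⟩
    have e := hr2 0 h
    have hy : 0 < 1 + (b 0)^2 * P2 := by positivity
    have hz : 0 < 1 + (a 0)^2 * P1 / (1 + (b 0)^2 * P2) := by positivity
    have e2 : 1 + (a 0)^2 * P1 + (b 0)^2 * P2
        = (1 + (a 0)^2 * P1 / (1 + (b 0)^2 * P2)) * (1 + (b 0)^2 * P2) := by
      field_simp
      ring
    rw [e2, Real.log_mul hz.ne' hy.ne', hr10] at e
    linarith
  | succ n ih =>
    intro h
    have hn : n < K := by omega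
    obtain ⟨i1, i2⟩ := ih hn
    obtain ⟨an, bn⟩ := hmono n hn
    have e1 := hr1 (n + 1) (by omega) h
    have e2 := hr2 n hn
    have e3 := hr2 (n + 1) h
    simp only [Nat.add_sub_cancel] at e1
    have ha : (a n)^2 * P1 ≤ (a (n+1))^2 * P1 := by
      have := hamono n h
      gcongr
    have hb : (b n)^2 * P2 ≤ (b (n+1))^2 * P2 := by
      have := hbmono n h
      gcongr
    have s1 := log_submod_aux _ _ ((b n)^2 * P2) (by positivity) ha (by positivity)
    have s2 := log_submod_aux _ _ ((a (n+1))^2 * P1) (by positivity) hb (by positivity)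
    rw [add_right_comm 1 ((b (n+1))^2 * P2), add_right_comm 1 ((b n)^2 * P2)] at s2
    constructor <;> linarith
end

section
/- Let μ1 and μ2 be finitely supported probability measures on [0,∞) with quantile functions h1 and h2, and let P1, P2 > 0. Then the supremum of ∫ R1 dμ1 + ∫ R2 dμ2 over all outage-free pairs (R1, R2) equals ∫_0^1 (1/2)log(1 + h1(x)²P1 + h2(x)²P2) dx, and the supremum is attained. -/
open MeasureTheory

/-- The (topological) support of a measure on `ℝ`: points all of whose
neighborhoods have positive measure. -/
def msupport (μ : Measure ℝ) : Set ℝ :=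
  {x | ∀ U ∈ nhds x, μ U ≠ 0}

/-- The quantile (inverse CDF) function of a measure on `[0,∞)`:
`h(x) = sup {g ≥ 0 : μ([0,g]) < x}` (with `sSup ∅ = 0`, so `h(0) = 0`). -/
noncomputable def quantile (μ : Measure ℝ) (x : ℝ) : ℝ :=
  sSup {g : ℝ | 0 ≤ g ∧ (μ (Set.Icc 0 g)).toReal < x}

/-- A pair of rate functions `R1, R2 : [0,∞) → [0,∞)` is outage free for
fading distributions `μ1, μ2` and powers `P1, P2`. -/
def OutageFree (μ1 μ2 : Measure ℝ) (P1 P2 : ℝ) (R1 R2 : ℝ → ℝ) : Prop :=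
  Measurable ((Set.Ici (0:ℝ)).restrict R1) ∧
  Measurable ((Set.Ici (0:ℝ)).restrict R2) ∧
  (∀ x ∈ Set.Ici (0:ℝ), 0 ≤ R1 x) ∧
  (∀ x ∈ Set.Ici (0:ℝ), 0 ≤ R2 x) ∧
  ∀ a ∈ msupport μ1, ∀ b ∈ msupport μ2,
    R1 a ≤ (1/2) * Real.log (1 + a^2 * P1) ∧
    R2 b ≤ (1/2) * Real.log (1 + b^2 * P2) ∧
    R1 a + R2 b ≤ (1/2) * Real.log (1 + a^2 * P1 + b^2 * P2)

/-- Dual potentials for a submodular cost along a finite chain. -/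
lemma chain_potentials {ι : Type*} [LinearOrder ι] (f : ℝ → ℝ → ℝ)
    (f0 : f 0 0 = 0) (fnn : ∀ a b, 0 ≤ f a b)
    (f1 : ∀ a a' b, a ≤ a' → f a b ≤ f a' b)
    (f2 : ∀ a b b', b ≤ b' → f a b ≤ f a b')
    (fs : ∀ a a' b b', a ≤ a' → b ≤ b' → f a b + f a' b' ≤ f a b' + f a' b)
    (h k : ι → ℝ) (hm : Monotone h) (km : Monotone k) (h0 : ∀ i, 0 ≤ h i) (k0 : ∀ i, 0 ≤ k i)
    (T : Finset ι) :
    ∃ (u v : ℝ → ℝ) (p q : ℝ), 0 ≤ p ∧ 0 ≤ q ∧ Monotone u ∧ Monotone v ∧ u 0 = 0 ∧ v 0 = 0 ∧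
      (∀ a, p ≤ a → u a = u p) ∧ (∀ b, q ≤ b → v b = v q) ∧
      (∀ a b, u a + v b ≤ f a b) ∧ u p + v q = f p q ∧
      (∀ i ∈ T, h i ≤ p ∧ k i ≤ q ∧ u (h i) + v (k i) = f (h i) (k i)) ∧
      (∀ j, (∀ i ∈ T, i < j) → p ≤ h j ∧ q ≤ k j) := by
  induction T using Finset.induction_on_max with
  | empty =>
    refine ⟨fun _ => 0, fun _ => 0, 0, 0, le_rfl, le_rfl, monotone_const, monotone_const, rfl, rfl,
      by simp, by simp, by simpa using fnn, by simp [f0], by simp, fun j _ => ⟨h0 j, k0 j⟩⟩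
  | insert i T hi ih =>
    obtain ⟨u, v, p, q, hp, hq, um, vm, u0, v0, uc, vc, uv, upq, hT, hj⟩ := ih
    obtain ⟨hpi, hqi⟩ := hj i hi
    set p' := h i with hp'
    set q' := k i with hq'
    let u' : ℝ → ℝ := fun a => u a + (f (max p (min a p')) q - f p q)
    have u'le : ∀ a, a ≤ p → u' a = u a := by
      intro a ha
      have : max p (min a p') = p := max_eq_left ((min_le_left _ _).trans ha)
      simp [u', this]
    have u'm : Monotone u' := by
      intro a b hab
      have h1 := um hab
      have h2 := f1 (max p (min a p')) (max p (min b p')) q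
        (max_le_max le_rfl (min_le_min hab le_rfl))
      simp only [u']; linarith
    have u'c : ∀ a, p' ≤ a → u' a = u' p' := by
      intro a ha
      simp only [u']
      rw [min_eq_right ha, min_self, uc a (hpi.trans ha), uc p' hpi]
    have u'v : ∀ a b, u' a + v b ≤ f a b := by
      intro a b
      rcases le_total a p with ha | ha
      · rw [u'le a ha]; exact uv a b
      · have e1 : v b ≤ v (min b q) := by
          rcases le_total b q with hb | hb
          · rw [min_eq_left hb]
          · rw [min_eq_right hb, vc b hb]
        have e2 : max p (min a p') = min a p' := max_eq_right (le_min ha hpi)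
        have e3 := uv p (min b q)
        have e4 := fs p (min a p') (min b q) q (le_min ha hpi) (min_le_right _ _)
        have e5 := f1 (min a p') a (min b q) (min_le_left _ _)
        have e6 := f2 a (min b q) b (min_le_left _ _)
        simp only [u']
        rw [e2, uc a ha]
        linarith
    have u'pq : u' p' + v q = f p' q := by
      simp only [u']
      rw [min_self, max_eq_right hpi, uc p' hpi]
      linarith
    let v' : ℝ → ℝ := fun b => v b + (f p' (max q (min b q')) - f p' q)
    have v'le : ∀ a, a ≤ q → v' a = v a := by
      intro a ha
      have : max q (min a q') = q := max_eq_left ((min_le_left _ _).trans ha)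
      simp [v', this]
    have v'm : Monotone v' := by
      intro a b hab
      have h1 := vm hab
      have h2 := f2 p' (max q (min a q')) (max q (min b q'))
        (max_le_max le_rfl (min_le_min hab le_rfl))
      simp only [v']; linarith
    have v'c : ∀ a, q' ≤ a → v' a = v' q' := by
      intro a ha
      simp only [v']
      rw [min_eq_right ha, min_self, vc a (hqi.trans ha), vc q' hqi]
    have u'v' : ∀ a b, u' a + v' b ≤ f a b := by
      intro a b
      rcases le_total b q with hb | hb
      · rw [v'le b hb]; exact u'v a b
      · have e1 : u' a ≤ u' (min a p') := by
          rcases le_total a p' with ha | ha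
          · rw [min_eq_left ha]
          · rw [min_eq_right ha, u'c a ha]
        have e2 : max q (min b q') = min b q' := max_eq_right (le_min hb hqi)
        have e3 := u'v (min a p') q
        have e4 := fs (min a p') p' q (min b q') (min_le_right _ _) (le_min hb hqi)
        have e5 := f2 (min a p') (min b q') b (min_le_left _ _)
        have e6 := f1 (min a p') a b (min_le_left _ _)
        simp only [v']
        rw [e2, vc b hb]
        linarith
    have u'v'pq : u' p' + v' q' = f p' q' := by
      simp only [v']
      rw [min_self, max_eq_right hqi, vc q' hqi]
      linarith
    refine ⟨u', v', p', q', h0 i, k0 i, u'm, v'm, by rw [u'le 0 hp, u0], by rw [v'le 0 hq, v0],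
      u'c, v'c, u'v', u'v'pq, ?_, ?_⟩
    · intro j hjT
      rcases Finset.mem_insert.1 hjT with rfl | hjT
      · exact ⟨le_rfl, le_rfl, u'v'pq⟩
      · obtain ⟨a1, a2, a3⟩ := hT j hjT
        exact ⟨a1.trans hpi, a2.trans hqi, by rw [u'le _ a1, v'le _ a2, a3]⟩
    · intro j hjT
      have : i ≤ j := (hjT i (Finset.mem_insert_self _ _)).le
      exact ⟨hm this, km this⟩

section Quantile

variable (μ : Measure ℝ) [IsProbabilityMeasure μ]

lemma quantile_nonneg (x : ℝ) : 0 ≤ quantile μ x :=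
  Real.sSup_nonneg fun _ hg => hg.1

lemma Icc_eq_cdf (hs : μ (Set.Iio 0) = 0) (g : ℝ) :
    (μ (Set.Icc 0 g)).toReal = ProbabilityTheory.cdf μ g := by
  rw [ProbabilityTheory.cdf_eq_real, Measure.real]
  congr 1
  apply measure_congr
  have : ∀ᵐ x ∂μ, ¬ x < 0 := by
    rw [ae_iff]; simpa [Set.Iio] using hs
  filter_upwards [this] with x hx
  apply propext
  change (0 ≤ x ∧ x ≤ g) ↔ x ≤ g
  simp [not_lt.1 hx]

lemma quantile_bdd (hfin : ∃ s : Finset ℝ, μ (↑s : Set ℝ)ᶜ = 0) (hs : μ (Set.Iio 0) = 0)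
    {x : ℝ} (hx : x ≤ 1) : BddAbove {g : ℝ | 0 ≤ g ∧ (μ (Set.Icc 0 g)).toReal < x} := by
  obtain ⟨s, hs'⟩ := hfin
  obtain ⟨M, hM⟩ := s.finite_toSet.bddAbove
  refine ⟨M, ?_⟩
  rintro g ⟨_, hg⟩
  by_contra hc
  push Not at hc
  rw [Icc_eq_cdf μ hs, ProbabilityTheory.cdf_eq_real] at hg
  have : μ (Set.Iic g) = 1 := by
    rw [prob_compl_eq_zero_iff measurableSet_Iic |>.symm]
    refine measure_mono_null ?_ hs'
    intro y hy hys
    exact hy ((hM hys).trans hc.le)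
  rw [Measure.real, this] at hg
  simp at hg
  linarith

lemma quantile_le_iff (hfin : ∃ s : Finset ℝ, μ (↑s : Set ℝ)ᶜ = 0) (hs : μ (Set.Iio 0) = 0)
    {x : ℝ} (hx : x ≤ 1) {g : ℝ} (hg : 0 ≤ g) :
    quantile μ x ≤ g ↔ x ≤ ProbabilityTheory.cdf μ g := by
  constructor
  · intro h
    by_contra hc
    push Not at hc
    have hr := (ProbabilityTheory.cdf μ).right_continuous g
    have h1 : ∀ᶠ y in nhdsWithin g (Set.Ioi g), ProbabilityTheory.cdf μ y < x :=
      (hr.mono Set.Ioi_subset_Ici_self).eventually_lt_const hc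
    obtain ⟨y, hy, hgy⟩ := (h1.and self_mem_nhdsWithin).exists
    have : y ≤ quantile μ x := le_csSup (quantile_bdd μ hfin hs hx)
      ⟨hg.trans (le_of_lt hgy), by rw [Icc_eq_cdf μ hs]; exact hy⟩
    exact absurd (this.trans h) (not_le.2 hgy)
  · intro h
    refine Real.sSup_le ?_ hg
    rintro y ⟨_, hy⟩
    rw [Icc_eq_cdf μ hs] at hy
    by_contra hc
    push Not at hc
    have := ProbabilityTheory.monotone_cdf μ hc.le
    linarith

lemma quantile_monotoneOn (hfin : ∃ s : Finset ℝ, μ (↑s : Set ℝ)ᶜ = 0)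
    (hs : μ (Set.Iio 0) = 0) : MonotoneOn (quantile μ) (Set.Ioc 0 1) := by
  intro x hx y hy hxy
  rw [quantile_le_iff μ hfin hs hx.2 (quantile_nonneg μ y)]
  exact hxy.trans ((quantile_le_iff μ hfin hs hy.2 (quantile_nonneg μ y)).1 le_rfl)

lemma quantile_aemeasurable (hfin : ∃ s : Finset ℝ, μ (↑s : Set ℝ)ᶜ = 0)
    (hs : μ (Set.Iio 0) = 0) : AEMeasurable (quantile μ) (volume.restrict (Set.Ioc 0 1)) :=
  aemeasurable_restrict_of_monotoneOn measurableSet_Ioc (quantile_monotoneOn μ hfin hs)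

lemma map_quantile (hfin : ∃ s : Finset ℝ, μ (↑s : Set ℝ)ᶜ = 0)
    (hs : μ (Set.Iio 0) = 0) :
    Measure.map (quantile μ) (volume.restrict (Set.Ioc 0 1)) = μ := by
  have hm := quantile_aemeasurable μ hfin hs
  haveI : IsFiniteMeasure (Measure.map (quantile μ) (volume.restrict (Set.Ioc (0:ℝ) 1))) :=
    Measure.isFiniteMeasure_map _ _
  refine Measure.ext_of_Iic _ _ fun g => ?_
  rw [Measure.map_apply_of_aemeasurable hm measurableSet_Iic]
  rcases lt_or_ge g 0 with hg | hg
  · have e : quantile μ ⁻¹' Set.Iic g = ∅ := by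
      ext x
      have := quantile_nonneg μ x
      simp only [Set.mem_preimage, Set.mem_Iic, Set.mem_empty_iff_false, iff_false]
      linarith
    rw [e, measure_empty, eq_comm]
    exact measure_mono_null (fun y (hy : y ≤ g) => lt_of_le_of_lt hy hg) hs
  · rw [Measure.restrict_apply' measurableSet_Ioc]
    have e : quantile μ ⁻¹' Set.Iic g ∩ Set.Ioc 0 1 = Set.Ioc 0 (ProbabilityTheory.cdf μ g) := by
      ext x
      constructor
      · rintro ⟨h1, h2⟩
        exact ⟨h2.1, (quantile_le_iff μ hfin hs h2.2 hg).1 h1⟩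
      · rintro ⟨h1, h2⟩
        have h3 := h2.trans (ProbabilityTheory.cdf_le_one μ g)
        exact ⟨(quantile_le_iff μ hfin hs h3 hg).2 h2, h1, h3⟩
    rw [e, Real.volume_Ioc, sub_zero, ProbabilityTheory.cdf_eq_real, Measure.real,
      ENNReal.ofReal_toReal (measure_ne_top _ _)]

lemma ae_mem_msupport (hfin : ∃ s : Finset ℝ, μ (↑s : Set ℝ)ᶜ = 0) :
    ∀ᵐ x ∂μ, x ∈ msupport μ := by
  obtain ⟨s, hs⟩ := hfin
  have h1 : ∀ᵐ x ∂μ, x ∈ s := by rw [ae_iff]; exact hs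
  have h2 : ∀ᵐ x ∂μ, ∀ y ∈ s, μ {y} = 0 → x ≠ y := by
    rw [Finset.eventually_all]
    intro y _
    by_cases hy : μ {y} = 0
    · have : ∀ᵐ x ∂μ, x ≠ y := by rw [ae_iff]; simpa using hy
      filter_upwards [this] with x hx _ using hx
    · filter_upwards with x h using absurd h hy
  filter_upwards [h1, h2] with x hx hx2 U hU h0
  exact hx2 x hx (measure_mono_null (Set.singleton_subset_iff.2 (mem_of_mem_nhds hU)) h0) rfl

lemma integrable_of_fin (hfin : ∃ s : Finset ℝ, μ (↑s : Set ℝ)ᶜ = 0) (R : ℝ → ℝ)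
    (hR : AEStronglyMeasurable R μ) : Integrable R μ := by
  obtain ⟨s, hs⟩ := hfin
  have h1 : ∀ᵐ x ∂μ, x ∈ s := by rw [ae_iff]; exact hs
  refine Integrable.of_bound hR (∑ y ∈ s, ‖R y‖) ?_
  filter_upwards [h1] with x hx
  exact Finset.single_le_sum (f := fun y => ‖R y‖) (fun _ _ => norm_nonneg _) hx

lemma aesm_of_restrict (hs : μ (Set.Iio 0) = 0) (R : ℝ → ℝ)
    (hR : Measurable ((Set.Ici (0:ℝ)).restrict R)) : AEStronglyMeasurable R μ := by
  have e : μ.restrict (Set.Ici 0) = μ := by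
    apply Measure.restrict_eq_self_of_ae_mem
    rw [ae_iff]
    simpa [Set.Iio] using hs
  rw [← e]
  exact (aemeasurable_restrict_of_measurable_subtype measurableSet_Ici hR).aestronglyMeasurable

end Quantile

theorem adaptive_sum_capacity_discrete
    (μ1 μ2 : Measure ℝ) [IsProbabilityMeasure μ1] [IsProbabilityMeasure μ2]
    (hsupp1 : μ1 (Set.Iio 0) = 0) (hsupp2 : μ2 (Set.Iio 0) = 0)
    (hfin1 : ∃ s : Finset ℝ, μ1 (↑s : Set ℝ)ᶜ = 0)
    (hfin2 : ∃ s : Finset ℝ, μ2 (↑s : Set ℝ)ᶜ = 0)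
    (P1 P2 : ℝ) (hP1 : 0 < P1) (hP2 : 0 < P2) :
    IsGreatest
      {v : ℝ | ∃ R1 R2 : ℝ → ℝ, OutageFree μ1 μ2 P1 P2 R1 R2 ∧
        v = (∫ x, R1 x ∂μ1) + (∫ x, R2 x ∂μ2)}
      (∫ x in (0:ℝ)..1,
        (1/2) * Real.log (1 + (quantile μ1 x)^2 * P1 + (quantile μ2 x)^2 * P2)) := by
  rw [intervalIntegral.integral_of_le zero_le_one]
  set ν : Measure ℝ := volume.restrict (Set.Ioc (0:ℝ) 1) with hν
  have m1 := quantile_aemeasurable μ1 hfin1 hsupp1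
  have m2 := quantile_aemeasurable μ2 hfin2 hsupp2
  have map1 := map_quantile μ1 hfin1 hsupp1
  have map2 := map_quantile μ2 hfin2 hsupp2
  rw [← hν] at m1 m2 map1 map2
  have tr1 : ∀ R : ℝ → ℝ, AEStronglyMeasurable R μ1 →
      Integrable (fun x => R (quantile μ1 x)) ν ∧ ∫ x, R (quantile μ1 x) ∂ν = ∫ x, R x ∂μ1 := by
    intro R hR
    have hi := integrable_of_fin μ1 hfin1 R hR
    rw [← map1] at hR hi
    refine ⟨hi.comp_aemeasurable m1, ?_⟩
    rw [← integral_map m1 hR, map1]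
  have tr2 : ∀ R : ℝ → ℝ, AEStronglyMeasurable R μ2 →
      Integrable (fun x => R (quantile μ2 x)) ν ∧ ∫ x, R (quantile μ2 x) ∂ν = ∫ x, R x ∂μ2 := by
    intro R hR
    have hi := integrable_of_fin μ2 hfin2 R hR
    rw [← map2] at hR hi
    refine ⟨hi.comp_aemeasurable m2, ?_⟩
    rw [← integral_map m2 hR, map2]
  have ms1 : ∀ᵐ x ∂ν, quantile μ1 x ∈ msupport μ1 := by
    have := ae_mem_msupport μ1 hfin1
    exact ae_of_ae_map m1 (by rw [map1]; exact this)
  have ms2 : ∀ᵐ x ∂ν, quantile μ2 x ∈ msupport μ2 := by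
    have := ae_mem_msupport μ2 hfin2
    exact ae_of_ae_map m2 (by rw [map2]; exact this)
  obtain ⟨s1, hs1⟩ := id hfin1
  obtain ⟨s2, hs2⟩ := id hfin2
  have fs1 : ∀ᵐ x ∂ν, quantile μ1 x ∈ s1 := by
    refine ae_of_ae_map m1 (p := fun y => y ∈ s1) ?_
    rw [map1, ae_iff]; exact hs1
  have fs2 : ∀ᵐ x ∂ν, quantile μ2 x ∈ s2 := by
    refine ae_of_ae_map m2 (p := fun y => y ∈ s2) ?_
    rw [map2, ae_iff]; exact hs2
  let X : ℝ → ℝ := fun a => (max a 0)^2 * P1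
  let Y : ℝ → ℝ := fun b => (max b 0)^2 * P2
  have X0 : ∀ a, 0 ≤ X a := fun a => by positivity
  have Y0 : ∀ a, 0 ≤ Y a := fun a => by positivity
  have Xm : Monotone X := fun a b hab =>
    mul_le_mul_of_nonneg_right (pow_le_pow_left₀ (le_max_right _ _) (max_le_max hab le_rfl) 2) hP1.le
  have Ym : Monotone Y := fun a b hab =>
    mul_le_mul_of_nonneg_right (pow_le_pow_left₀ (le_max_right _ _) (max_le_max hab le_rfl) 2) hP2.le
  let f : ℝ → ℝ → ℝ := fun a b => (1/2) * Real.log (1 + X a + Y b)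
  have fpos : ∀ a b, 0 < 1 + X a + Y b := fun a b => by have := X0 a; have := Y0 b; linarith
  have feq : ∀ a b, 0 ≤ a → 0 ≤ b → f a b = (1/2) * Real.log (1 + a^2 * P1 + b^2 * P2) := by
    intro a b ha hb
    simp only [f, X, Y, max_eq_left ha, max_eq_left hb]
  let D : Set ℝ := {x | x ∈ Set.Ioc (0:ℝ) 1 ∧ quantile μ1 x ∈ s1 ∧ quantile μ2 x ∈ s2}
  let φ : D → ℝ × ℝ := fun x => (quantile μ1 x, quantile μ2 x)
  have hfinr : (Set.range φ).Finite := by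
    refine (s1 ×ˢ s2).finite_toSet.subset ?_
    rintro _ ⟨x, rfl⟩
    simpa [φ] using x.2.2
  obtain ⟨T, hT⟩ : ∃ T : Finset D, ∀ x, ∃ t ∈ T, φ t = φ x := by
    classical
    have := hfinr.fintype
    choose g hg using fun y : Set.range φ => y.2
    refine ⟨Finset.univ.image g, fun x => ⟨g ⟨φ x, x, rfl⟩, by simp, hg _⟩⟩
  obtain ⟨u, v, p, q, -, -, um, vm, u0, v0, -, -, uv, -, huvT, -⟩ :=
    chain_potentials (ι := D) f (by simp [f, X, Y])
      (fun a b => by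
        have := Real.log_nonneg (x := 1 + X a + Y b) (by have := X0 a; have := Y0 b; linarith)
        simp only [f]; linarith)
      (fun a a' b h => by
        have := Real.log_le_log (fpos a b) (show 1 + X a + Y b ≤ 1 + X a' + Y b by
          have := Xm h; linarith)
        simp only [f]; linarith)
      (fun a b b' h => by
        have := Real.log_le_log (fpos a b) (show 1 + X a + Y b ≤ 1 + X a + Y b' by
          have := Ym h; linarith)
        simp only [f]; linarith)
      (fun a a' b b' ha hb => by
        have h1 := Xm ha
        have h2 := Ym hb
        have := Real.log_le_log (mul_pos (fpos a b) (fpos a' b'))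
          (show (1 + X a + Y b) * (1 + X a' + Y b') ≤ (1 + X a + Y b') * (1 + X a' + Y b) by
            nlinarith [mul_nonneg (sub_nonneg.2 h1) (sub_nonneg.2 h2)])
        rw [Real.log_mul (fpos _ _).ne' (fpos _ _).ne',
          Real.log_mul (fpos _ _).ne' (fpos _ _).ne'] at this
        simp only [f]; linarith)
      (fun x => quantile μ1 x) (fun x => quantile μ2 x)
      (fun x y h => quantile_monotoneOn μ1 hfin1 hsupp1 x.2.1 y.2.1 h)
      (fun x y h => quantile_monotoneOn μ2 hfin2 hsupp2 x.2.1 y.2.1 h)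
      (fun x => quantile_nonneg μ1 x) (fun x => quantile_nonneg μ2 x) T
  have key : ∀ᵐ x ∂ν, u (quantile μ1 x) + v (quantile μ2 x) =
      (1/2) * Real.log (1 + (quantile μ1 x)^2 * P1 + (quantile μ2 x)^2 * P2) := by
    filter_upwards [fs1, fs2, ae_restrict_mem measurableSet_Ioc] with x h1 h2 h3
    obtain ⟨t, ht, hφ⟩ := hT ⟨x, h3, h1, h2⟩
    have e1 : quantile μ1 t = quantile μ1 x := congrArg Prod.fst hφ
    have e2 : quantile μ2 t = quantile μ2 x := congrArg Prod.snd hφ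
    have := (huvT t ht).2.2
    rw [e1, e2] at this
    rw [this, feq _ _ (quantile_nonneg μ1 x) (quantile_nonneg μ2 x)]
  obtain ⟨iu, eu⟩ := tr1 u um.measurable.aestronglyMeasurable
  obtain ⟨iv, ev⟩ := tr2 v vm.measurable.aestronglyMeasurable
  have sup1 : ∀ a ∈ msupport μ1, 0 ≤ a := fun a ha => by
    by_contra hc
    exact ha _ (Iio_mem_nhds (not_le.1 hc)) hsupp1
  have sup2 : ∀ a ∈ msupport μ2, 0 ≤ a := fun a ha => by
    by_contra hc
    exact ha _ (Iio_mem_nhds (not_le.1 hc)) hsupp2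
  constructor
  · refine ⟨u, v, ⟨um.measurable.comp measurable_subtype_coe,
      vm.measurable.comp measurable_subtype_coe, fun x hx => u0 ▸ um hx, fun x hx => v0 ▸ vm hx,
      fun a ha b hb => ⟨?_, ?_, ?_⟩⟩, ?_⟩
    · have := uv a 0
      rw [feq a 0 (sup1 a ha) le_rfl, v0] at this
      simpa using this
    · have := uv 0 b
      rw [feq 0 b le_rfl (sup2 b hb), u0] at this
      simpa using this
    · rw [← feq a b (sup1 a ha) (sup2 b hb)]
      exact uv a b
    · rw [← eu, ← ev, ← integral_add iu iv]
      exact (integral_congr_ae key).symm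
  · rintro w ⟨R1, R2, ⟨hR1, hR2, -, -, hR⟩, rfl⟩
    obtain ⟨i1, e1⟩ := tr1 R1 (aesm_of_restrict μ1 hsupp1 R1 hR1)
    obtain ⟨i2, e2⟩ := tr2 R2 (aesm_of_restrict μ2 hsupp2 R2 hR2)
    rw [← e1, ← e2, ← integral_add i1 i2]
    refine integral_mono_ae (i1.add i2) ((iu.add iv).congr key) ?_
    filter_upwards [ms1, ms2] with x h1 h2
    exact (hR _ h1 _ h2).2.2
end

section
/- Let K ≥ 1, let 0 ≤ a_0 ≤ … ≤ a_{K−1} and 0 ≤ b_0 ≤ … ≤ b_{K−1} be nondecreasing sequences of reals, let P1, P2 > 0, and let r1_i, r2_i (0 ≤ i ≤ K−1) be reals satisfying: r1_0 + r2_0 = (1/2)log(1 + a_0²P1 + b_0²P2), r1_0 ≤ (1/2)log(1 + a_0²P1), r2_0 ≤ (1/2)log(1 + b_0²P2); and for every 1 ≤ i ≤ K−1: r1_i + r2_i = (1/2)log(1 + a_i²P1 + b_i²P2), r1_i + r2_{i−1} ≤ (1/2)log(1 + a_i²P1 + b_{i−1}²P2), and r1_{i−1} + r2_i ≤ (1/2)log(1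 + a_{i−1}²P1 + b_i²P2). Then for all 0 ≤ i, j ≤ K−1, r1_i + r2_j ≤ (1/2)log(1 + a_i²P1 + b_j²P2). -/
lemma log_submod (X X' Y Y' : ℝ) (hX : 0 ≤ X) (hY : 0 ≤ Y) (hXX : X ≤ X') (hYY : Y ≤ Y') :
    Real.log (1 + X' + Y') + Real.log (1 + X + Y)
      ≤ Real.log (1 + X + Y') + Real.log (1 + X' + Y) := by
  rw [← Real.log_mul (by apply ne_of_gt; linarith) (by apply ne_of_gt; linarith),
    ← Real.log_mul (by apply ne_of_gt; linarith) (by apply ne_of_gt; linarith)]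
  apply Real.log_le_log
  · apply mul_pos <;> linarith
  · nlinarith [mul_nonneg (sub_nonneg.2 hXX) (sub_nonneg.2 hYY)]

/-- One-sided version, abstracted over the squared gains. -/
lemma upper_aux (K : ℕ) (x y p q : ℕ → ℝ)
    (hx0 : ∀ i < K, 0 ≤ x i) (hy0 : ∀ i < K, 0 ≤ y i)
    (hx : ∀ i, i + 1 < K → x i ≤ x (i + 1)) (hy : ∀ i, i + 1 < K → y i ≤ y (i + 1))
    (hs : ∀ i < K, p i + q i = (1/2) * Real.log (1 + x i + y i))
    (hc : ∀ i, i + 1 < K → p i + q (i + 1) ≤ (1/2) * Real.log (1 + x i + y (i + 1)))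
    (i j : ℕ) (hij : i ≤ j) (hj : j < K) :
    x i ≤ x j ∧ p i + q j ≤ (1/2) * Real.log (1 + x i + y j) := by
  induction j, hij using Nat.le_induction with
  | base => exact ⟨le_rfl, (hs i hj).le⟩
  | succ j hij ih =>
    obtain ⟨h1, h2⟩ := ih (by omega)
    refine ⟨h1.trans (hx j hj), ?_⟩
    have h3 := log_submod (x i) (x j) (y j) (y (j + 1)) (hx0 i (by omega)) (hy0 j (by omega))
      h1 (hy j hj)
    have h4 := hs j (by omega)
    have h5 := hc j hj
    linarith

theorem general_rate_allocation_outage_free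
    (K : ℕ) (hK : 1 ≤ K) (a b : ℕ → ℝ) (P1 P2 : ℝ)
    (hP1 : 0 < P1) (hP2 : 0 < P2)
    (ha0 : 0 ≤ a 0) (hb0 : 0 ≤ b 0)
    (hamono : ∀ i, i + 1 < K → a i ≤ a (i + 1))
    (hbmono : ∀ i, i + 1 < K → b i ≤ b (i + 1))
    (r1 r2 : ℕ → ℝ)
    (hsum0 : r1 0 + r2 0 = (1/2) * Real.log (1 + (a 0)^2 * P1 + (b 0)^2 * P2))
    (hind10 : r1 0 ≤ (1/2) * Real.log (1 + (a 0)^2 * P1))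
    (hind20 : r2 0 ≤ (1/2) * Real.log (1 + (b 0)^2 * P2))
    (hsum : ∀ i, 1 ≤ i → i < K →
      r1 i + r2 i = (1/2) * Real.log (1 + (a i)^2 * P1 + (b i)^2 * P2))
    (hcomp1 : ∀ i, 1 ≤ i → i < K →
      r1 i + r2 (i - 1) ≤ (1/2) * Real.log (1 + (a i)^2 * P1 + (b (i - 1))^2 * P2))
    (hcomp2 : ∀ i, 1 ≤ i → i < K →
      r1 (i - 1) + r2 i ≤ (1/2) * Real.log (1 + (a (i - 1))^2 * P1 + (b i)^2 * P2)) :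
    ∀ i < K, ∀ j < K,
      r1 i + r2 j ≤ (1/2) * Real.log (1 + (a i)^2 * P1 + (b j)^2 * P2) := by
  have han : ∀ i < K, 0 ≤ a i := by
    intro i
    induction i with
    | zero => exact fun _ => ha0
    | succ i ih => exact fun h => (ih (by omega)).trans (hamono i h)
  have hbn : ∀ i < K, 0 ≤ b i := by
    intro i
    induction i with
    | zero => exact fun _ => hb0
    | succ i ih => exact fun h => (ih (by omega)).trans (hbmono i h)
  have hx0 : ∀ i < K, 0 ≤ (a i)^2 * P1 := fun i _ => by positivity
  have hy0 : ∀ i < K, 0 ≤ (b i)^2 * P2 := fun i _ => by positivity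
  have hx : ∀ i, i + 1 < K → (a i)^2 * P1 ≤ (a (i + 1))^2 * P1 := fun i h =>
    mul_le_mul_of_nonneg_right (pow_le_pow_left₀ (han i (by omega)) (hamono i h) 2) hP1.le
  have hy : ∀ i, i + 1 < K → (b i)^2 * P2 ≤ (b (i + 1))^2 * P2 := fun i h =>
    mul_le_mul_of_nonneg_right (pow_le_pow_left₀ (hbn i (by omega)) (hbmono i h) 2) hP2.le
  have hs : ∀ i < K, r1 i + r2 i = (1/2) * Real.log (1 + (a i)^2 * P1 + (b i)^2 * P2) := by
    intro i h
    rcases Nat.eq_zero_or_pos i with rfl | h0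
    · exact hsum0
    · exact hsum i h0 h
  intro i hi j hj
  rcases le_total i j with hij | hij
  · exact (upper_aux K (fun i => (a i)^2 * P1) (fun i => (b i)^2 * P2) r1 r2 hx0 hy0 hx hy hs
      (fun i h => hcomp2 (i + 1) (by omega) h) i j hij hj).2
  · have := (upper_aux K (fun i => (b i)^2 * P2) (fun i => (a i)^2 * P1) r2 r1 hy0 hx0 hy hx
      (fun i h => by rw [add_comm, hs i h, add_right_comm])
      (fun i h => by
        have := hcomp1 (i + 1) (by omega) h
        rw [add_comm, add_right_comm]
        exact this) j i hij hi).2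
    rw [add_comm, add_right_comm]
    exact this
end

section
/- Let R1, R2 be the two-user continuous rate allocation. Then for all h1, h2 ≥ 0, R1(h1) + R2(h2) ≤ (1/2)log(1 + h1²P1 + h2²P2). -/
theorem rate_integrable (χ : ℝ → ℝ) (P Q : ℝ) (hP : 0 < P) (hQ : 0 < Q)
    (hχ0 : ∀ y, 0 ≤ y → 0 ≤ χ y) (hχ : MonotoneOn χ (Set.Ici 0))
    (a b : ℝ) (ha : 0 ≤ a) (hb : 0 ≤ b) :
    IntervalIntegrable (fun y => y * P / (1 + y^2 * P + (χ y)^2 * Q)) MeasureTheory.volume a b := by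
  have hsub : ∀ y ∈ Set.uIcc a b, 0 ≤ y := fun y hy => (le_min ha hb).trans hy.1
  have h1 : IntervalIntegrable (fun y => (1 + y^2 * P + (χ y)^2 * Q)⁻¹) MeasureTheory.volume a b := by
    apply AntitoneOn.intervalIntegrable
    intro x hx y hy hxy
    have hx0 := hsub x hx
    have hy0 := hsub y hy
    have h2 := hχ hx0 hy0 hxy
    have h3 := hχ0 x hx0
    simp only
    gcongr
  simp only [div_eq_mul_inv]
  exact h1.continuousOn_mul (g := fun y => y * P) (by fun_prop)

theorem rate_step (χ : ℝ → ℝ) (P Q : ℝ) (hP : 0 < P) (hQ : 0 < Q)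
    (hχ0 : ∀ y, 0 ≤ y → 0 ≤ χ y) (hχ : MonotoneOn χ (Set.Ici 0))
    (a b c : ℝ) (ha : 0 ≤ a) (hab : a ≤ b) (hc0 : 0 ≤ c) (hc : c ≤ χ a) :
    (∫ y in (0:ℝ)..b, y * P / (1 + y^2 * P + (χ y)^2 * Q))
      - (∫ y in (0:ℝ)..a, y * P / (1 + y^2 * P + (χ y)^2 * Q)) ≤
    (1/2) * Real.log (1 + b^2 * P + c^2 * Q) - (1/2) * Real.log (1 + a^2 * P + c^2 * Q) := by
  rw [intervalIntegral.integral_interval_sub_left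
    (rate_integrable χ P Q hP hQ hχ0 hχ _ _ le_rfl (ha.trans hab))
    (rate_integrable χ P Q hP hQ hχ0 hχ _ _ le_rfl ha)]
  have hint : IntervalIntegrable (fun y => y * P / (1 + y^2 * P + c^2 * Q))
      MeasureTheory.volume a b :=
    rate_integrable (fun _ => c) P Q hP hQ (fun _ _ => hc0) (fun _ _ _ _ _ => le_rfl) a b ha
      (ha.trans hab)
  rw [← intervalIntegral.integral_eq_sub_of_hasDerivAt
    (f := fun y => (1/2) * Real.log (1 + y^2 * P + c^2 * Q)) ?_ hint]
  · apply intervalIntegral.integral_mono_on hab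
      (rate_integrable χ P Q hP hQ hχ0 hχ _ _ ha (ha.trans hab)) hint
    intro y hy
    have hy0 : 0 ≤ y := ha.trans hy.1
    have h2 : c ≤ χ y := hc.trans (hχ ha hy0 hy.1)
    gcongr
  · intro y _
    have hpos : 1 + y^2 * P + c^2 * Q ≠ 0 := by positivity
    have h1 : HasDerivAt (fun y : ℝ => 1 + y^2 * P + c^2 * Q) (2 * y * P) y := by
      have := (((hasDerivAt_pow 2 y).mul_const P).const_add 1).add_const (c^2 * Q)
      simpa using this
    refine ((h1.log hpos).const_mul (1/2)).congr_deriv ?_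
    field_simp

theorem log_mixed (A A' B B' : ℝ) (hA : 0 ≤ A) (hAA : A ≤ A') (hB : 0 ≤ B) (hBB : B ≤ B') :
    Real.log (1 + A' + B) + Real.log (1 + A + B') - Real.log (1 + A + B) - Real.log (1 + A' + B')
      ≤ (A' - A) * (B' - B) := by
  have p1 : 0 < 1 + A + B := by linarith
  have p2 : 0 < 1 + A' + B' := by linarith
  have p3 : 0 < 1 + A' + B := by linarith
  have p4 : 0 < 1 + A + B' := by linarith
  rw [sub_sub, ← Real.log_mul p3.ne' p4.ne', ← Real.log_mul p1.ne' p2.ne',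
    ← Real.log_div (by positivity) (by positivity)]
  refine (Real.log_le_sub_one_of_pos (by positivity)).trans ?_
  have : (1 + A' + B) * (1 + A + B') / ((1 + A + B) * (1 + A' + B')) - 1
      = (A' - A) * (B' - B) / ((1 + A + B) * (1 + A' + B')) := by
    field_simp
    ring
  rw [this]
  apply div_le_self (mul_nonneg (by linarith) (by linarith))
  nlinarith [mul_nonneg (show 0 ≤ A + B by linarith) (show 0 ≤ A' + B' by linarith)]

theorem rate_curve (φ χ : ℝ → ℝ) (P1 P2 : ℝ) (hP1 : 0 < P1) (hP2 : 0 < P2)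
    (hφ0 : ∀ y, 0 ≤ y → 0 ≤ φ y) (hφ : MonotoneOn φ (Set.Ici 0))
    (hχ0 : ∀ y, 0 ≤ y → 0 ≤ χ y) (hχ : MonotoneOn χ (Set.Ici 0))
    (hχφ : ∀ y, 0 ≤ y → χ (φ y) = y) (hz : φ 0 = 0)
    (T : ℝ) (hT : 0 ≤ T) :
    (∫ y in (0:ℝ)..T, y * P1 / (1 + y^2 * P1 + (φ y)^2 * P2))
      + (∫ y in (0:ℝ)..(φ T), y * P2 / (1 + y^2 * P2 + (χ y)^2 * P1)) ≤
    (1/2) * Real.log (1 + T^2 * P1 + (φ T)^2 * P2) := by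
  set I1 : ℝ → ℝ := fun h => ∫ y in (0:ℝ)..h, y * P1 / (1 + y^2 * P1 + (φ y)^2 * P2) with hI1
  set I2 : ℝ → ℝ := fun h => ∫ y in (0:ℝ)..h, y * P2 / (1 + y^2 * P2 + (χ y)^2 * P1) with hI2
  set G : ℝ → ℝ := fun t => I1 t + I2 (φ t) - (1/2) * Real.log (1 + t^2 * P1 + (φ t)^2 * P2) with hG
  have step : ∀ s t, 0 ≤ s → s ≤ t →
      G t - G s ≤ (1/2) * ((t^2 * P1 - s^2 * P1) * ((φ t)^2 * P2 - (φ s)^2 * P2)) := by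
    intro s t hs hst
    have ht := hs.trans hst
    have hm := hφ hs ht hst
    have hs0 := hφ0 s hs
    have e1 : I1 t - I1 s ≤ _ := rate_step φ P1 P2 hP1 hP2 hφ0 hφ s t (φ s) hs hst hs0 le_rfl
    have e2 : I2 (φ t) - I2 (φ s) ≤ _ := rate_step χ P2 P1 hP2 hP1 hχ0 hχ (φ s) (φ t) s hs0 hm hs
      (hχφ s hs).ge
    have e3 := log_mixed (s^2 * P1) (t^2 * P1) ((φ s)^2 * P2) ((φ t)^2 * P2) (by positivity)
      (by gcongr) (by positivity) (by gcongr)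
    have c1 : 1 + (φ t)^2 * P2 + s^2 * P1 = 1 + s^2 * P1 + (φ t)^2 * P2 := by ring
    have c2 : 1 + (φ s)^2 * P2 + s^2 * P1 = 1 + s^2 * P1 + (φ s)^2 * P2 := by ring
    rw [c1, c2] at e2
    simp only [hG]
    linarith
  have hG0 : G 0 = 0 := by simp [hG, hI1, hI2, hz]
  have bound : ∀ n : ℕ, G T ≤ (T^2 * P1 * ((φ T)^2 * P2)) / ((n:ℝ) + 1) := by
    intro n
    have hn : (0:ℝ) < (n:ℝ) + 1 := by positivity
    have key : ∀ k : ℕ, k ≤ n + 1 → G (k * (T / (n+1))) ≤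
        (T^2 * P1 / (n+1)) * ((φ (k * (T / (n+1))))^2 * P2) := by
      intro k
      induction k with
      | zero => intro _; simp [hG0, hz]
      | succ k ih =>
        intro hk
        have ih := ih (by omega)
        have hδ : 0 ≤ T / ((n:ℝ)+1) := by positivity
        have hs : 0 ≤ (k:ℝ) * (T / (n+1)) := by positivity
        have hst : (k:ℝ) * (T / (n+1)) ≤ ((k+1 : ℕ):ℝ) * (T / (n+1)) := by
          push_cast; gcongr; linarith
        have st := step _ _ hs hst
        have hm := hφ hs (hs.trans hst) hst
        have hs0 := hφ0 _ hs
        have hB : 0 ≤ (φ (((k+1 : ℕ):ℝ) * (T / (n+1))))^2 * P2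
            - (φ ((k:ℝ) * (T / (n+1))))^2 * P2 := by
          rw [sub_nonneg]; gcongr
        have hA : (1/2) * ((((k+1 : ℕ):ℝ) * (T / (n+1)))^2 * P1 - ((k:ℝ) * (T / (n+1)))^2 * P1)
            ≤ T^2 * P1 / (n+1) := by
          have hk' : (k:ℝ) + 1 ≤ n + 1 := by exact_mod_cast hk
          have : (1/2) * ((((k+1 : ℕ):ℝ) * (T / (n+1)))^2 * P1 - ((k:ℝ) * (T / (n+1)))^2 * P1)
            = (T^2 * P1 / (n+1)) * ((2 * k + 1) / (2 * (n + 1))) := by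
            push_cast
            field_simp
            ring
          rw [this]
          apply mul_le_of_le_one_right (by positivity)
          rw [div_le_one (by positivity)]
          linarith
        have := mul_le_mul_of_nonneg_right hA hB
        linarith
    have := key (n+1) le_rfl
    have e : ((n+1 : ℕ):ℝ) * (T / (n+1)) = T := by push_cast; field_simp
    rw [e] at this
    calc G T ≤ _ := this
      _ = _ := by ring
  have lim : Filter.Tendsto (fun n : ℕ => (T^2 * P1 * ((φ T)^2 * P2)) / ((n:ℝ) + 1))
      Filter.atTop (nhds 0) := by
    have := (tendsto_one_div_add_atTop_nhds_zero_nat (𝕜 := ℝ)).const_mul (T^2 * P1 * ((φ T)^2 * P2))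
    simpa [div_eq_mul_inv] using this
  have : G T ≤ 0 := ge_of_tendsto' lim bound
  simp only [hG] at this
  linarith

theorem rate_half (φ χ : ℝ → ℝ) (P1 P2 : ℝ) (hP1 : 0 < P1) (hP2 : 0 < P2)
    (hφ0 : ∀ y, 0 ≤ y → 0 ≤ φ y) (hφ : MonotoneOn φ (Set.Ici 0))
    (hχ0 : ∀ y, 0 ≤ y → 0 ≤ χ y) (hχ : MonotoneOn χ (Set.Ici 0))
    (hχφ : ∀ y, 0 ≤ y → χ (φ y) = y) (hz : φ 0 = 0)
    (h1 h2 : ℝ) (hh1 : 0 ≤ h1) (h12 : φ h1 ≤ h2) :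
    (∫ y in (0:ℝ)..h1, y * P1 / (1 + y^2 * P1 + (φ y)^2 * P2))
      + (∫ y in (0:ℝ)..h2, y * P2 / (1 + y^2 * P2 + (χ y)^2 * P1)) ≤
    (1/2) * Real.log (1 + h1^2 * P1 + h2^2 * P2) := by
  have e1 := rate_curve φ χ P1 P2 hP1 hP2 hφ0 hφ hχ0 hχ hχφ hz h1 hh1
  have e2 := rate_step χ P2 P1 hP2 hP1 hχ0 hχ (φ h1) h2 h1 (hφ0 _ hh1) h12 hh1 (hχφ _ hh1).ge
  have c1 : 1 + (φ h1)^2 * P2 + h1^2 * P1 = 1 + h1^2 * P1 + (φ h1)^2 * P2 := by ring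
  have c2 : 1 + h2^2 * P2 + h1^2 * P1 = 1 + h1^2 * P1 + h2^2 * P2 := by ring
  rw [c1, c2] at e2
  linarith

theorem comp_mono (ψ1 ψ2 inv2 : ℝ → ℝ)
    (hm1 : StrictMonoOn ψ1 (Set.Ici 0)) (hm2 : StrictMonoOn ψ2 (Set.Ici 0))
    (hrange1 : ∀ h ∈ Set.Ici (0:ℝ), ψ1 h ∈ Set.Ico (0:ℝ) 1)
    (hinv2 : ∀ x ∈ Set.Ico (0:ℝ) 1, 0 ≤ inv2 x ∧ ψ2 (inv2 x) = x) :
    MonotoneOn (fun y => inv2 (ψ1 y)) (Set.Ici 0) := by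
  intro a ha b hb hab
  by_contra! hlt
  obtain ⟨a0, a1⟩ := hinv2 _ (hrange1 a ha)
  obtain ⟨b0, b1⟩ := hinv2 _ (hrange1 b hb)
  have := hm2 b0 a0 hlt
  rw [a1, b1] at this
  exact absurd (hm1.monotoneOn ha hb hab) (not_le.2 this)

theorem continuous_rate_allocation_sum_constraint
    (ψ1 ψ2 inv1 inv2 : ℝ → ℝ) (P1 P2 : ℝ)
    (hP1 : 0 < P1) (hP2 : 0 < P2)
    (hc1 : ContinuousOn ψ1 (Set.Ici 0)) (hc2 : ContinuousOn ψ2 (Set.Ici 0))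
    (hm1 : StrictMonoOn ψ1 (Set.Ici 0)) (hm2 : StrictMonoOn ψ2 (Set.Ici 0))
    (h10 : ψ1 0 = 0) (h20 : ψ2 0 = 0)
    (ht1 : Filter.Tendsto ψ1 Filter.atTop (nhds 1))
    (ht2 : Filter.Tendsto ψ2 Filter.atTop (nhds 1))
    (hrange1 : ∀ h ∈ Set.Ici (0:ℝ), ψ1 h ∈ Set.Ico (0:ℝ) 1)
    (hrange2 : ∀ h ∈ Set.Ici (0:ℝ), ψ2 h ∈ Set.Ico (0:ℝ) 1)
    (hinv1 : ∀ x ∈ Set.Ico (0:ℝ) 1, 0 ≤ inv1 x ∧ ψ1 (inv1 x) = x)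
    (hinv2 : ∀ x ∈ Set.Ico (0:ℝ) 1, 0 ≤ inv2 x ∧ ψ2 (inv2 x) = x)
    (hinv1' : ∀ h ∈ Set.Ici (0:ℝ), inv1 (ψ1 h) = h)
    (hinv2' : ∀ h ∈ Set.Ici (0:ℝ), inv2 (ψ2 h) = h)
    (R1 R2 : ℝ → ℝ)
    (hR1 : ∀ h, R1 h =
      ∫ y in (0:ℝ)..h, y * P1 / (1 + y^2 * P1 + (inv2 (ψ1 y))^2 * P2))
    (hR2 : ∀ h, R2 h =
      ∫ y in (0:ℝ)..h, y * P2 / (1 + y^2 * P2 + (inv1 (ψ2 y))^2 * P1)) :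
    ∀ h1 h2 : ℝ, 0 ≤ h1 → 0 ≤ h2 →
      R1 h1 + R2 h2 ≤ (1/2) * Real.log (1 + h1^2 * P1 + h2^2 * P2) := by
  intro h1 h2 hh1 hh2
  rw [hR1, hR2]
  have m1 := comp_mono ψ1 ψ2 inv2 hm1 hm2 hrange1 hinv2
  have m2 := comp_mono ψ2 ψ1 inv1 hm2 hm1 hrange2 hinv1
  have n1 : ∀ y, 0 ≤ y → 0 ≤ inv2 (ψ1 y) := fun y hy => (hinv2 _ (hrange1 y hy)).1
  have n2 : ∀ y, 0 ≤ y → 0 ≤ inv1 (ψ2 y) := fun y hy => (hinv1 _ (hrange2 y hy)).1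
  have k1 : ∀ y, 0 ≤ y → inv1 (ψ2 (inv2 (ψ1 y))) = y := fun y hy => by
    rw [(hinv2 _ (hrange1 y hy)).2, hinv1' y hy]
  have k2 : ∀ y, 0 ≤ y → inv2 (ψ1 (inv1 (ψ2 y))) = y := fun y hy => by
    rw [(hinv1 _ (hrange2 y hy)).2, hinv2' y hy]
  have z1 : inv2 (ψ1 0) = 0 := by
    have := hinv2' 0 Set.self_mem_Ici
    rw [h20] at this
    rw [h10, this]
  have z2 : inv1 (ψ2 0) = 0 := by
    have := hinv1' 0 Set.self_mem_Ici
    rw [h10] at this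
    rw [h20, this]
  rcases le_total (inv2 (ψ1 h1)) h2 with hle | hle
  · exact rate_half (fun y => inv2 (ψ1 y)) (fun y => inv1 (ψ2 y)) P1 P2 hP1 hP2 n1 m1 n2 m2 k1 z1
      h1 h2 hh1 hle
  · have hle' : inv1 (ψ2 h2) ≤ h1 := by
      have := m2 hh2 (n1 h1 hh1) hle
      simp only at this
      rwa [k1 h1 hh1] at this
    have := rate_half (fun y => inv1 (ψ2 y)) (fun y => inv2 (ψ1 y)) P2 P1 hP2 hP1 n2 m2 n1 m1 k2 z2
      h2 h1 hh2 hle'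
    have c : 1 + h2^2 * P2 + h1^2 * P1 = 1 + h1^2 * P1 + h2^2 * P2 := by ring
    rw [c] at this
    linarith
end

section
/- Let R1, R2 be the two-user continuous rate allocation. Then for every x ∈ [0,1), R1(ψ1^{-1}(x)) + R2(ψ2^{-1}(x)) = (1/2)log(1 + (ψ1^{-1}(x))²P1 + (ψ2^{-1}(x))²P2). -/
theorem rate_core (e : ℝ ≃o ℝ) (he : e 0 = 0) (P1 P2 : ℝ) (hP1 : 0 < P1) (hP2 : 0 < P2) (h : ℝ) :
    (∫ y in (0:ℝ)..h, y * P1 / (1 + y^2 * P1 + (e y)^2 * P2)) +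
    (∫ y in (0:ℝ)..(e h), y * P2 / (1 + y^2 * P2 + (e.symm y)^2 * P1)) =
      (1/2) * Real.log (1 + h^2 * P1 + (e h)^2 * P2) := by
  have hec : Continuous e := e.continuous
  have hec' : Continuous e.symm := e.symm.continuous
  set f1 : ℝ → ℝ := fun y => y * P1 / (1 + y^2 * P1 + (e y)^2 * P2) with hf1
  set f2 : ℝ → ℝ := fun y => y * P2 / (1 + y^2 * P2 + (e.symm y)^2 * P1) with hf2
  have c1 : Continuous f1 := by
    refine Continuous.div (by fun_prop) (by fun_prop) (fun y => ?_)
    positivity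
  have c2 : Continuous f2 := by
    refine Continuous.div (by fun_prop) (by fun_prop) (fun y => ?_)
    positivity
  set G : ℝ × ℝ → ℝ := fun p => (∫ y in (0:ℝ)..p.1, f1 y) + (∫ y in (0:ℝ)..p.2, f2 y)
    - (1/2) * Real.log (1 + p.1^2 * P1 + p.2^2 * P2) with hG
  have dG : ∀ a : ℝ, HasFDerivAt G (0 : ℝ × ℝ →L[ℝ] ℝ) (a, e a) := by
    intro a
    have d1 : HasFDerivAt (fun p : ℝ × ℝ => p.1) (ContinuousLinearMap.fst ℝ ℝ ℝ) (a, e a) :=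
      hasFDerivAt_fst
    have d2 : HasFDerivAt (fun p : ℝ × ℝ => p.2) (ContinuousLinearMap.snd ℝ ℝ ℝ) (a, e a) :=
      hasFDerivAt_snd
    have i1 := (c1.integral_hasStrictDerivAt 0 a).hasDerivAt.comp_hasFDerivAt (a, e a) d1
    have i2 := (c2.integral_hasStrictDerivAt 0 (e a)).hasDerivAt.comp_hasFDerivAt (a, e a) d2
    have hpos : 0 < 1 + a^2 * P1 + (e a)^2 * P2 := by positivity
    have l := ((((d1.pow 2).mul_const P1).const_add 1).add ((d2.pow 2).mul_const P2)).log hpos.ne'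
    have := (i1.add i2).sub (l.const_mul (1/2))
    refine this.congr_fderiv ?_
    ext <;> simp [hf1, hf2] <;> field_simp <;> ring
  -- reparametrisation by `y + e y`
  have hm : StrictMono (fun y => y + e y) := strictMono_id.add e.strictMono
  have hs : Function.Surjective (fun y => y + e y) := by
    refine Continuous.surjective (by fun_prop) ?_ ?_
    · exact Filter.tendsto_id.atTop_add_atTop e.tendsto_atTop
    · exact Filter.tendsto_id.atBot_add_atBot e.tendsto_atBot
  let φ : ℝ ≃o ℝ := hm.orderIsoOfSurjective _ hs
  have hφ : ∀ y, φ y = y + e y := fun y => rfl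
  have hφs : ∀ t, φ.symm t + e (φ.symm t) = t := fun t => by
    rw [← hφ]; exact φ.apply_symm_apply t
  have lip : ∀ s t, ‖((φ.symm s, e (φ.symm s)) : ℝ × ℝ) - (φ.symm t, e (φ.symm t))‖ ≤ 1 * ‖s - t‖ := by
    intro s t
    have h1 := hφs s
    have h2 := hφs t
    rw [one_mul, Prod.mk_sub_mk, Prod.norm_mk, Real.norm_eq_abs, Real.norm_eq_abs, Real.norm_eq_abs]
    rcases le_total s t with hst | hst
    · have m1 := φ.symm.monotone hst
      have m2 := e.monotone m1
      rw [abs_of_nonpos (by linarith), abs_of_nonpos (by linarith), abs_of_nonpos (by linarith)]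
      exact max_le (by linarith) (by linarith)
    · have m1 := φ.symm.monotone hst
      have m2 := e.monotone m1
      rw [abs_of_nonneg (by linarith), abs_of_nonneg (by linarith), abs_of_nonneg (by linarith)]
      exact max_le (by linarith) (by linarith)
  have dH : ∀ t, HasDerivAt (fun t => G (φ.symm t, e (φ.symm t))) 0 t := by
    intro t
    have h1 := (dG (φ.symm t)).isLittleO
    have hc : Filter.Tendsto (fun s => ((φ.symm s, e (φ.symm s)) : ℝ × ℝ)) (nhds t)
        (nhds (φ.symm t, e (φ.symm t))) := by
      have : Continuous φ.symm := φ.symm.continuous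
      exact (Continuous.prodMk this (hec.comp this)).tendsto t
    have h2 := h1.comp_tendsto hc
    have h3 : (fun s => ((φ.symm s, e (φ.symm s)) : ℝ × ℝ) - (φ.symm t, e (φ.symm t)))
        =O[nhds t] (fun s => s - t) :=
      Asymptotics.IsBigO.of_bound 1 (Filter.Eventually.of_forall fun s => lip s t)
    have h4 := h2.trans_isBigO h3
    rw [hasDerivAt_iff_isLittleO]
    simpa [Function.comp_def] using h4
  have key := is_const_of_deriv_eq_zero (fun t => (dH t).differentiableAt)
    (fun t => (dH t).deriv) (φ h) (φ 0)
  simp only [OrderIso.symm_apply_apply, he] at key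
  simp [hG] at key
  simp only [one_div]
  linarith

theorem ext_iso (g k : ℝ → ℝ) (hg : StrictMonoOn g (Set.Ici 0)) (g0 : g 0 = 0)
    (hk : ∀ y, 0 ≤ y → 0 ≤ k y) (hgk : ∀ y, 0 ≤ y → g (k y) = y) :
    ∃ e : ℝ ≃o ℝ, (∀ y, 0 ≤ y → e y = g y) ∧ (∀ y, 0 ≤ y → e.symm y = k y) := by
  have hm : StrictMono (fun y => if 0 ≤ y then g y else y) := by
    intro a b hab
    by_cases ha : 0 ≤ a
    · have hb : 0 ≤ b := ha.trans hab.le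
      simpa [ha, hb] using hg ha hb hab
    · by_cases hb : 0 ≤ b
      · have := hg.monotoneOn (Set.mem_Ici.2 le_rfl) hb hb
        simp only [ha, hb, if_true, if_false]
        linarith [not_le.1 ha]
      · simpa [ha, hb] using hab
  refine ⟨hm.orderIsoOfRightInverse _ (fun y => if 0 ≤ y then k y else y) ?_, ?_, ?_⟩
  · intro y
    by_cases hy : 0 ≤ y
    · simp [hy, hk y hy, hgk y hy]
    · simp [hy]
  · intro y hy
    simp [hy]
  · intro y hy
    change (if 0 ≤ y then k y else y) = k y
    simp [hy]


theorem continuous_rate_allocation_dominant_face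
    (ψ1 ψ2 inv1 inv2 : ℝ → ℝ) (P1 P2 : ℝ)
    (hP1 : 0 < P1) (hP2 : 0 < P2)
    (hc1 : ContinuousOn ψ1 (Set.Ici 0)) (hc2 : ContinuousOn ψ2 (Set.Ici 0))
    (hm1 : StrictMonoOn ψ1 (Set.Ici 0)) (hm2 : StrictMonoOn ψ2 (Set.Ici 0))
    (h10 : ψ1 0 = 0) (h20 : ψ2 0 = 0)
    (ht1 : Filter.Tendsto ψ1 Filter.atTop (nhds 1))
    (ht2 : Filter.Tendsto ψ2 Filter.atTop (nhds 1))
    (hrange1 : ∀ h ∈ Set.Ici (0:ℝ), ψ1 h ∈ Set.Ico (0:ℝ) 1)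
    (hrange2 : ∀ h ∈ Set.Ici (0:ℝ), ψ2 h ∈ Set.Ico (0:ℝ) 1)
    (hinv1 : ∀ x ∈ Set.Ico (0:ℝ) 1, 0 ≤ inv1 x ∧ ψ1 (inv1 x) = x)
    (hinv2 : ∀ x ∈ Set.Ico (0:ℝ) 1, 0 ≤ inv2 x ∧ ψ2 (inv2 x) = x)
    (hinv1' : ∀ h ∈ Set.Ici (0:ℝ), inv1 (ψ1 h) = h)
    (hinv2' : ∀ h ∈ Set.Ici (0:ℝ), inv2 (ψ2 h) = h)
    (R1 R2 : ℝ → ℝ)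
    (hR1 : ∀ h, R1 h =
      ∫ y in (0:ℝ)..h, y * P1 / (1 + y^2 * P1 + (inv2 (ψ1 y))^2 * P2))
    (hR2 : ∀ h, R2 h =
      ∫ y in (0:ℝ)..h, y * P2 / (1 + y^2 * P2 + (inv1 (ψ2 y))^2 * P1)) :
    ∀ x ∈ Set.Ico (0:ℝ) 1,
      R1 (inv1 x) + R2 (inv2 x) =
        (1/2) * Real.log (1 + (inv1 x)^2 * P1 + (inv2 x)^2 * P2) := by
  intro x hx
  obtain ⟨a0, ax⟩ := hinv1 x hx
  obtain ⟨b0, bx⟩ := hinv2 x hx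
  have nn : ∀ y, 0 ≤ y → 0 ≤ inv1 (ψ2 y) := fun y hy => (hinv1 _ (hrange2 y hy)).1
  obtain ⟨e, he, hes⟩ := ext_iso (fun y => inv2 (ψ1 y)) (fun y => inv1 (ψ2 y))
    (by
      intro a ha b hb hab
      by_contra hcon
      have p := hinv2 _ (hrange1 a ha)
      have q := hinv2 _ (hrange1 b hb)
      have := hm2.monotoneOn (Set.mem_Ici.2 q.1) (Set.mem_Ici.2 p.1) (not_lt.1 hcon)
      rw [p.2, q.2] at this
      exact absurd (hm1 ha hb hab) (not_lt.2 this))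
    (by
      have := hinv2' 0 (Set.mem_Ici.2 le_rfl)
      rw [h20] at this
      simpa [h10] using this)
    nn
    (by
      intro y hy
      rw [(hinv1 _ (hrange2 y hy)).2]
      exact hinv2' y hy)
  have e0 : e 0 = 0 := by
    rw [he 0 le_rfl]
    have := hinv2' 0 (Set.mem_Ici.2 le_rfl)
    rw [h20] at this
    simpa [h10] using this
  have ea : e (inv1 x) = inv2 x := by rw [he _ a0]; simp only [ax]
  have key := rate_core e e0 P1 P2 hP1 hP2 (inv1 x)
  rw [ea] at key
  rw [← key, hR1, hR2]
  congr 1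
  · apply intervalIntegral.integral_congr
    intro y hy
    rw [Set.uIcc_of_le a0] at hy
    simp only [he y hy.1]
  · apply intervalIntegral.integral_congr
    intro y hy
    rw [Set.uIcc_of_le b0] at hy
    simp only [hes y hy.1]
end

section
/- Let R_1, …, R_N be the N-user continuous rate allocation. Then for every x ∈ [0,1), ∑_{i=1}^N R_i(ψ_i^{-1}(x)) = (1/2)log(1 + ∑_{j=1}^N (ψ_j^{-1}(x))² P_j). -/
theorem eq_of_sq_bound (D S : ℝ → ℝ) (X : ℝ) (hX : 0 ≤ X)
    (hS : ContinuousOn S (Set.Icc 0 X)) (hmono : S 0 ≤ S X)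
    (hD : ∀ x ∈ Set.Icc 0 X, ∀ y ∈ Set.Icc 0 X, |D y - D x| ≤ (S y - S x)^2) :
    D X = D 0 := by
  have hivt := intermediate_value_Icc hX hS
  have hex : ∀ t ∈ Set.Icc (S 0) (S X), ∃ x ∈ Set.Icc 0 X, S x = t := fun t ht => hivt ht
  choose! σ hσ hσS using hex
  set p : ℝ → ℝ := fun t => (Set.projIcc (S 0) (S X) hmono t : ℝ) with hp
  have hpm : ∀ t, p t ∈ Set.Icc (S 0) (S X) := fun t => (Set.projIcc (S 0) (S X) hmono t).2
  have hpl : ∀ s t, |p t - p s| ≤ |t - s| := fun s t => by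
    have := (LipschitzWith.projIcc hmono).dist_le_mul t s
    simpa [Subtype.dist_eq, Real.dist_eq] using this
  set h : ℝ → ℝ := fun t => D (σ (p t)) with hh
  have hb : ∀ s t, |h t - h s| ≤ (t - s)^2 := fun s t => by
    have h1 := hD _ (hσ _ (hpm s)) _ (hσ _ (hpm t))
    rw [hσS _ (hpm s), hσS _ (hpm t)] at h1
    exact h1.trans (sq_le_sq.mpr (hpl s t))
  have hder : ∀ s, HasDerivAt h 0 s := fun s => by
    rw [hasDerivAt_iff_isLittleO]
    have h1 : (fun t => h t - h s - (t - s) • (0:ℝ)) =O[nhds s] fun t => (t - s)^2 := by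
      refine Asymptotics.IsBigO.of_bound 1 (Filter.Eventually.of_forall fun t => ?_)
      have := hb s t
      simpa using this
    refine h1.trans_isLittleO ?_
    have := Asymptotics.isLittleO_pow_sub_sub s (m := 2) (by norm_num)
    simpa using this
  have hconst := is_const_of_deriv_eq_zero (fun s => (hder s).differentiableAt)
    (fun s => (hder s).deriv) (S X) (S 0)
  have key : ∀ x ∈ Set.Icc 0 X, S x ∈ Set.Icc (S 0) (S X) → h (S x) = D x := by
    intro x hx hSx
    have hpx : p (S x) = S x := by simp [hp, Set.projIcc_of_mem hmono hSx]
    have h1 := hD _ hx _ (hσ _ hSx)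
    rw [hσS _ hSx, sub_self] at h1
    have h2 : |D (σ (S x)) - D x| = 0 := le_antisymm (by simpa using h1) (abs_nonneg _)
    have h3 := abs_eq_zero.mp h2
    simp only [hh, hpx]
    linarith
  rw [key X ⟨hX, le_rfl⟩ ⟨hmono, le_rfl⟩, key 0 ⟨le_rfl, hX⟩ ⟨le_rfl, hmono⟩] at hconst
  exact hconst

theorem multiuser_continuous_rate_allocation_dominant_face
    (N : ℕ) (hN : 1 ≤ N)
    (ψ inv : Fin N → ℝ → ℝ) (P : Fin N → ℝ)
    (hP : ∀ i, 0 < P i)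
    (hc : ∀ i, ContinuousOn (ψ i) (Set.Ici 0))
    (hm : ∀ i, StrictMonoOn (ψ i) (Set.Ici 0))
    (h0 : ∀ i, ψ i 0 = 0)
    (ht : ∀ i, Filter.Tendsto (ψ i) Filter.atTop (nhds 1))
    (hrange : ∀ i, ∀ h ∈ Set.Ici (0:ℝ), ψ i h ∈ Set.Ico (0:ℝ) 1)
    (hinv : ∀ i, ∀ x ∈ Set.Ico (0:ℝ) 1, 0 ≤ inv i x ∧ ψ i (inv i x) = x)
    (hinv' : ∀ i, ∀ h ∈ Set.Ici (0:ℝ), inv i (ψ i h) = h)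
    (R : Fin N → ℝ → ℝ)
    (hR : ∀ i h, R i h =
      ∫ y in (0:ℝ)..h, y * P i /
        (1 + y^2 * P i + ∑ j ∈ Finset.univ.erase i, (inv j (ψ i y))^2 * P j)) :
    ∀ x ∈ Set.Ico (0:ℝ) 1,
      ∑ i, R i (inv i x) =
        (1/2) * Real.log (1 + ∑ j, (inv j x)^2 * P j) := by
  have hmonoI : ∀ i, MonotoneOn (inv i) (Set.Ico 0 1) := by
    intro i x hx y hy hxy
    have h1 := hinv i x hx
    have h2 := hinv i y hy
    by_contra hlt
    push Not at hlt
    have := hm i (Set.mem_Ici.2 h2.1) (Set.mem_Ici.2 h1.1) hlt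
    rw [h1.2, h2.2] at this
    linarith
  have hcontI : ∀ i, ContinuousOn (inv i) (Set.Ico 0 1) := by
    intro i
    let f : Set.Ico (0:ℝ) 1 → Set.Ici (0:ℝ) := fun x => ⟨inv i x, (hinv i x x.2).1⟩
    have hf : Monotone f := fun x y hxy => hmonoI i x.2 y.2 hxy
    have hs : Function.Surjective f := fun y =>
      ⟨⟨ψ i y, hrange i y y.2⟩, Subtype.ext (hinv' i y y.2)⟩
    have hfc : Continuous f := hf.continuous_of_surjective hs
    rw [continuousOn_iff_continuous_restrict]
    exact continuous_subtype_val.comp hfc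
  set S : ℝ → ℝ := fun x => 1 + ∑ j, (inv j x)^2 * P j with hSdef
  have hScont : ContinuousOn S (Set.Ico 0 1) := by
    refine continuousOn_const.add (continuousOn_finsetSum _ fun j _ => ?_)
    exact ((hcontI j).pow 2).mul continuousOn_const
  have hSmono : MonotoneOn S (Set.Ico 0 1) := by
    intro x hx y hy hxy
    refine add_le_add le_rfl (Finset.sum_le_sum fun j _ => ?_)
    exact mul_le_mul_of_nonneg_right
      (pow_le_pow_left₀ (hinv j x hx).1 (hmonoI j hx hy hxy) 2) (hP j).le
  have hS1 : ∀ x, 1 ≤ S x := fun x => by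
    have : 0 ≤ ∑ j, (inv j x)^2 * P j :=
      Finset.sum_nonneg fun j _ => mul_nonneg (sq_nonneg _) (hP j).le
    simp only [hSdef]; linarith
  have hinv0 : ∀ i, inv i 0 = 0 := fun i => by
    have := hinv' i 0 Set.self_mem_Ici
    rwa [h0] at this
  have hden : ∀ i, ∀ y ∈ Set.Ici (0:ℝ), 1 + y^2 * P i +
      ∑ j ∈ Finset.univ.erase i, (inv j (ψ i y))^2 * P j = S (ψ i y) := by
    intro i y hy
    simp only [hSdef]
    rw [← Finset.add_sum_erase Finset.univ _ (Finset.mem_univ i), hinv' i y hy, add_assoc]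
  have hR' : ∀ i, ∀ h ∈ Set.Ici (0:ℝ), R i h = ∫ y in (0:ℝ)..h, y * P i / S (ψ i y) := by
    intro i h hh
    rw [hR]
    refine intervalIntegral.integral_congr fun y hy => ?_
    rw [Set.uIcc_of_le hh] at hy
    rw [hden i y hy.1]
  have hgc : ∀ i, ContinuousOn (fun y => y * P i / S (ψ i y)) (Set.Ici 0) := by
    intro i
    refine (continuousOn_id.mul continuousOn_const).div (hScont.comp (hc i) (hrange i)) ?_
    intro y _
    have := hS1 (ψ i y)
    positivity
  have hgi : ∀ i u v, 0 ≤ u → 0 ≤ v →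
      IntervalIntegrable (fun y => y * P i / S (ψ i y)) MeasureTheory.volume u v := by
    intro i u v hu hv
    refine ContinuousOn.intervalIntegrable ((hgc i).mono fun y hy => ?_)
    exact le_trans (le_min hu hv) hy.1
  have hconstI : ∀ i u v c, ∫ y in u..v, y * P i / c = (v^2 - u^2) * P i / (2 * c) := by
    intro i u v c
    have : (fun y : ℝ => y * P i / c) = fun y => y * (P i / c) := by
      funext y; ring
    rw [this, intervalIntegral.integral_mul_const, integral_id]
    ring
  have hdiff : ∀ x ∈ Set.Ico (0:ℝ) 1, ∀ y ∈ Set.Ico (0:ℝ) 1, x ≤ y → ∀ i,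
      ((inv i y)^2 - (inv i x)^2) * P i / (2 * S y) ≤ R i (inv i y) - R i (inv i x) ∧
      R i (inv i y) - R i (inv i x) ≤ ((inv i y)^2 - (inv i x)^2) * P i / (2 * S x) := by
    intro x hx y hy hxy i
    have hx0 := (hinv i x hx).1
    have hy0 := (hinv i y hy).1
    have hle := hmonoI i hx hy hxy
    rw [hR' i _ hx0, hR' i _ hy0, intervalIntegral.integral_interval_sub_left
      (hgi i _ _ le_rfl hy0) (hgi i _ _ le_rfl hx0), ← hconstI, ← hconstI]
    have hci : ∀ c, IntervalIntegrable (fun y => y * P i / c) MeasureTheory.volume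
        (inv i x) (inv i y) := fun c => by
      apply Continuous.intervalIntegrable
      fun_prop
    have hb : ∀ u ∈ Set.Icc (inv i x) (inv i y), 0 ≤ u ∧ S x ≤ S (ψ i u) ∧ S (ψ i u) ≤ S y := by
      intro u hu
      have hu0 : 0 ≤ u := hx0.trans hu.1
      have h1 := (hm i).monotoneOn hx0 hu0 hu.1
      have h2 := (hm i).monotoneOn hu0 hy0 hu.2
      rw [(hinv i x hx).2] at h1
      rw [(hinv i y hy).2] at h2
      exact ⟨hu0, hSmono hx (hrange i u hu0) h1, hSmono (hrange i u hu0) hy h2⟩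
    constructor
    · refine intervalIntegral.integral_mono_on hle (hci _) (hgi i _ _ hx0 hy0) fun u hu => ?_
      obtain ⟨h1, h2, h3⟩ := hb u hu
      exact div_le_div_of_nonneg_left (mul_nonneg h1 (hP i).le)
        (by linarith [hS1 (ψ i u)]) h3
    · refine intervalIntegral.integral_mono_on hle (hgi i _ _ hx0 hy0) (hci _) fun u hu => ?_
      obtain ⟨h1, h2, h3⟩ := hb u hu
      exact div_le_div_of_nonneg_left (mul_nonneg h1 (hP i).le)
        (by linarith [hS1 x]) h2
  have hsum : ∀ x y c, ∑ i, ((inv i y)^2 - (inv i x)^2) * P i / c = (S y - S x) / c := by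
    intro x y c
    rw [← Finset.sum_div]
    congr 1
    simp only [hSdef, sub_mul, Finset.sum_sub_distrib]
    ring
  set D : ℝ → ℝ := fun x => ∑ i, R i (inv i x) - (1/2) * Real.log (S x) with hDdef
  have hDle : ∀ x ∈ Set.Ico (0:ℝ) 1, ∀ y ∈ Set.Ico (0:ℝ) 1, x ≤ y →
      |D y - D x| ≤ (S y - S x)^2 := by
    intro x hx y hy hxy
    have hA := hS1 x
    have hB := hS1 y
    have hAB := hSmono hx hy hxy
    have l1 := Finset.sum_le_sum fun i (_ : i ∈ Finset.univ) => (hdiff x hx y hy hxy i).1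
    have l2 := Finset.sum_le_sum fun i (_ : i ∈ Finset.univ) => (hdiff x hx y hy hxy i).2
    rw [hsum, Finset.sum_sub_distrib] at l1 l2
    have hA0 : 0 < S x := by linarith
    have hB0 : 0 < S y := by linarith
    have g1 := Real.log_le_sub_one_of_pos (div_pos hB0 hA0)
    have g2 := Real.log_le_sub_one_of_pos (div_pos hA0 hB0)
    rw [Real.log_div hB0.ne' hA0.ne'] at g1
    rw [Real.log_div hA0.ne' hB0.ne'] at g2
    have e1 : (S y - S x) / (2 * S x) = (S y / S x - 1) / 2 := by field_simp
    have e2 : (S y - S x) / (2 * S y) = (1 - S x / S y) / 2 := by field_simp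
    have e3 : (S y / S x - 1) / 2 - (1 - S x / S y) / 2 ≤ (S y - S x)^2 := by
      have : (S y / S x - 1) / 2 - (1 - S x / S y) / 2
          = (S y - S x)^2 / (2 * (S x * S y)) := by
        field_simp
      rw [this]
      apply div_le_self (sq_nonneg _)
      nlinarith
    rw [e2] at l1
    rw [e1] at l2
    simp only [hDdef]
    rw [abs_le]
    constructor <;> linarith
  intro x hx
  have hsub : Set.Icc 0 x ⊆ Set.Ico (0:ℝ) 1 := fun y hy => ⟨hy.1, hy.2.trans_lt hx.2⟩
  have hfin := eq_of_sq_bound D S x hx.1 (hScont.mono hsub)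
    (hSmono ⟨le_rfl, one_pos⟩ hx hx.1) (by
      intro a ha b hb
      rcases le_total a b with h | h
      · exact hDle a (hsub ha) b (hsub hb) h
      · rw [abs_sub_comm, sub_sq_comm]
        exact hDle b (hsub hb) a (hsub ha) h)
  have hD0 : D 0 = 0 := by
    simp [hDdef, hSdef, hinv0, hR]
  rw [hD0] at hfin
  simp only [hDdef] at hfin
  linarith
end

section
/- Let R_1, …, R_N be the N-user continuous rate allocation. Then for every subset S ⊆ {1, …, N} and all h_i ≥ 0 (i ∈ S), ∑_{i∈S} R_i(h_i) ≤ (1/2)log(1 + ∑_{i∈S} h_i² P_i). -/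
lemma aux_log (G A : ℝ → ℝ) (hG : ContinuousOn G (Set.Ici 0)) (hpos : ∀ t, 0 ≤ t → 0 < G t)
    (hA : ∀ s t, 0 ≤ s → s ≤ t → A t - A s ≤ (G t - G s) / G s)
    (hmono : ∀ s t, 0 ≤ s → s ≤ t → G s ≤ G t)
    (s t : ℝ) (hs : 0 ≤ s) (hst : s ≤ t) :
    A t - A s ≤ Real.log (G t) - Real.log (G s) := by
  have key : ∀ n : ℕ, ∀ s t, 0 ≤ s → s ≤ t →
      A t - A s ≤ 2 ^ n * (Real.exp ((Real.log (G t) - Real.log (G s)) / 2 ^ n) - 1) := by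
    intro n
    induction n with
    | zero =>
      intro s t hs hst
      have h1 := hpos s hs
      have h2 := hpos t (hs.trans hst)
      have := hA s t hs hst
      simp only [pow_zero, div_one, one_mul, Real.exp_sub, Real.exp_log h1, Real.exp_log h2]
      rwa [sub_div, div_self h1.ne'] at this
    | succ n ih =>
      intro s t hs hst
      have h1 := hpos s hs
      have h2 := hpos t (hs.trans hst)
      have hcont : ContinuousOn (fun u => Real.log (G u)) (Set.Icc s t) := by
        apply ContinuousOn.log
        · exact hG.mono (fun u hu => hs.trans hu.1)
        · intro u hu
          exact (hpos u (hs.trans hu.1)).ne'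
      have hle := Real.log_le_log h1 (hmono s t hs hst)
      obtain ⟨u, hu, hu2⟩ := intermediate_value_Icc hst hcont
        (show (Real.log (G s) + Real.log (G t)) / 2 ∈ _ from ⟨by linarith, by linarith⟩)
      simp only at hu2
      have e1 := ih s u hs hu.1
      have e2 := ih u t (hs.trans hu.1) hu.2
      have q1 : (Real.log (G u) - Real.log (G s)) / 2 ^ n
          = (Real.log (G t) - Real.log (G s)) / 2 ^ (n + 1) := by
        rw [hu2, pow_succ]; field_simp; ring
      have q2 : (Real.log (G t) - Real.log (G u)) / 2 ^ n
          = (Real.log (G t) - Real.log (G s)) / 2 ^ (n + 1) := by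
        rw [hu2, pow_succ]; field_simp; ring
      rw [q1] at e1
      rw [q2] at e2
      rw [pow_succ] at *
      linarith
  set L := Real.log (G t) - Real.log (G s) with hL
  have hL0 : 0 ≤ L := sub_nonneg.2 (Real.log_le_log (hpos s hs) (hmono s t hs hst))
  have hlim : Filter.Tendsto (fun n : ℕ => L + L ^ 2 * (1 / 2 : ℝ) ^ n) Filter.atTop
      (nhds (L + L ^ 2 * 0)) :=
    tendsto_const_nhds.add (tendsto_const_nhds.mul
      (tendsto_pow_atTop_nhds_zero_of_lt_one (by norm_num) (by norm_num)))
  rw [mul_zero, add_zero] at hlim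
  refine ge_of_tendsto hlim ?_
  have hp : ∀ᶠ n : ℕ in Filter.atTop, L ≤ (2 : ℝ) ^ n :=
    (tendsto_pow_atTop_atTop_of_one_lt (by norm_num : (1 : ℝ) < 2)).eventually_ge_atTop L
  filter_upwards [hp] with n hn
  have h2 : (0 : ℝ) < 2 ^ n := by positivity
  have hx : |L / 2 ^ n| ≤ 1 := by
    rw [abs_of_nonneg (by positivity)]
    exact (div_le_one h2).2 hn
  have hb := (abs_le.1 (Real.abs_exp_sub_one_sub_id_le hx)).2
  have hk := key n s t hs hst
  have hm := mul_le_mul_of_nonneg_left hb h2.le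
  have e : (2 : ℝ) ^ n * (L / 2 ^ n) ^ 2 = L ^ 2 * (1 / 2) ^ n := by
    rw [one_div, inv_pow]; field_simp
  have e' : (2 : ℝ) ^ n * (L / 2 ^ n) = L := by field_simp
  rw [e] at hm
  rw [← hL] at hk
  have : (2 : ℝ) ^ n * (Real.exp (L / 2 ^ n) - 1 - L / 2 ^ n)
    = 2 ^ n * (Real.exp (L / 2 ^ n) - 1) - L := by rw [mul_sub, e']
  linarith

lemma aux_inv (ψ inv : ℝ → ℝ) (hm : StrictMonoOn ψ (Set.Ici 0))
    (hrange : ∀ h ∈ Set.Ici (0:ℝ), ψ h ∈ Set.Ico (0:ℝ) 1)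
    (hinv : ∀ x ∈ Set.Ico (0:ℝ) 1, 0 ≤ inv x ∧ ψ (inv x) = x) :
    MonotoneOn inv (Set.Ico 0 1) ∧ ContinuousOn inv (Set.Ico 0 1) := by
  have hmono : MonotoneOn inv (Set.Ico 0 1) := by
    intro a ha b hb hab
    have h1 := hinv a ha
    have h2 := hinv b hb
    rw [← hm.le_iff_le (a := inv a) (b := inv b) h1.1 h2.1, h1.2, h2.2]
    exact hab
  refine ⟨hmono, ?_⟩
  let f : Set.Ici (0:ℝ) → Set.Ico (0:ℝ) 1 := fun y => ⟨ψ y, hrange y y.2⟩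
  let g : Set.Ico (0:ℝ) 1 → Set.Ici (0:ℝ) := fun x => ⟨inv x, (hinv x x.2).1⟩
  have hf : StrictMono f := fun a b hab => hm a.2 b.2 hab
  have hfg : Function.RightInverse g f := fun x => Subtype.ext (hinv x x.2).2
  let e := StrictMono.orderIsoOfRightInverse f hf g hfg
  rw [continuousOn_iff_continuous_domRestrict]
  exact continuous_subtype_val.comp e.symm.continuous

lemma aux_main
    (N : ℕ)
    (ψ inv : Fin N → ℝ → ℝ) (P : Fin N → ℝ)
    (hP : ∀ i, 0 < P i)
    (hc : ∀ i, ContinuousOn (ψ i) (Set.Ici 0))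
    (hm : ∀ i, StrictMonoOn (ψ i) (Set.Ici 0))
    (h0 : ∀ i, ψ i 0 = 0)
    (hrange : ∀ i, ∀ h ∈ Set.Ici (0:ℝ), ψ i h ∈ Set.Ico (0:ℝ) 1)
    (hinv : ∀ i, ∀ x ∈ Set.Ico (0:ℝ) 1, 0 ≤ inv i x ∧ ψ i (inv i x) = x)
    (hinv' : ∀ i, ∀ h ∈ Set.Ici (0:ℝ), inv i (ψ i h) = h)
    (R : Fin N → ℝ → ℝ)
    (hR : ∀ i h, R i h =
      ∫ y in (0:ℝ)..h, y * P i /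
        (1 + y^2 * P i + ∑ j ∈ Finset.univ.erase i, (inv j (ψ i y))^2 * P j))
    (S : Finset (Fin N)) (h : Fin N → ℝ) (hh : ∀ i, 0 ≤ h i) :
      ∑ i ∈ S, R i (h i) ≤
        (1/2) * Real.log (1 + ∑ i ∈ S, (h i)^2 * P i) := by
  have hI := fun i => aux_inv (ψ i) (inv i) (hm i) (hrange i) (hinv i)
  have hx : ∀ i, ψ i (h i) ∈ Set.Ico (0:ℝ) 1 := fun i => hrange i _ (hh i)
  have hmin : ∀ i t, 0 ≤ t → min t (ψ i (h i)) ∈ Set.Ico (0:ℝ) 1 := fun i t ht =>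
    ⟨le_min ht (hx i).1, (min_le_right _ _).trans_lt (hx i).2⟩
  set c : Fin N → ℝ → ℝ := fun i t => inv i (min t (ψ i (h i))) with hcdef
  have c0 : ∀ i, c i 0 = 0 := by
    intro i
    have : c i 0 = inv i (ψ i 0) := by simp only [hcdef, h0, min_eq_left (hx i).1]
    rw [this, hinv' i 0 (Set.mem_Ici.2 le_rfl)]
  have c1 : ∀ i, c i 1 = h i := by
    intro i
    simp only [hcdef, min_eq_right (hx i).2.le]
    exact hinv' i _ (hh i)
  have cnn : ∀ i t, 0 ≤ t → 0 ≤ c i t := fun i t ht => (hinv i _ (hmin i t ht)).1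
  have cmono : ∀ i s t, 0 ≤ s → s ≤ t → c i s ≤ c i t := fun i s t hs hst =>
    (hI i).1 (hmin i s hs) (hmin i t (hs.trans hst)) (min_le_min_right _ hst)
  have ccont : ∀ i, ContinuousOn (c i) (Set.Ici 0) := fun i =>
    (hI i).2.comp (by fun_prop) (fun t ht => hmin i t ht)
  set G : ℝ → ℝ := fun t => 1 + ∑ i ∈ S, (c i t)^2 * P i with hGdef
  have Gpos : ∀ t, 0 < G t := fun t =>
    add_pos_of_pos_of_nonneg one_pos
      (Finset.sum_nonneg fun i _ => mul_nonneg (sq_nonneg _) (hP i).le)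
  have Gcont : ContinuousOn G (Set.Ici 0) :=
    continuousOn_const.add (continuousOn_finsetSum _ fun i _ =>
      ((ccont i).pow 2).mul continuousOn_const)
  have Gmono : ∀ s t, 0 ≤ s → s ≤ t → G s ≤ G t := by
    intro s t hs hst
    simp only [hGdef]
    gcongr with i hi
    · exact (hP i).le
    · exact cnn i s hs
    · exact cmono i s t hs hst
  set D : Fin N → ℝ → ℝ := fun i y =>
    1 + y^2 * P i + ∑ j ∈ Finset.univ.erase i, (inv j (ψ i y))^2 * P j with hD
  have Dpos : ∀ i y, 0 < D i y := fun i y =>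
    add_pos_of_pos_of_nonneg
      (add_pos_of_pos_of_nonneg one_pos (mul_nonneg (sq_nonneg _) (hP i).le))
      (Finset.sum_nonneg fun j _ => mul_nonneg (sq_nonneg _) (hP j).le)
  have Deq : ∀ i y, 0 ≤ y → D i y = 1 + ∑ j, (inv j (ψ i y))^2 * P j := by
    intro i y hy
    rw [← Finset.add_sum_erase _ _ (Finset.mem_univ i), hinv' i y hy, ← add_assoc]
  have Dcont : ∀ i, ContinuousOn (D i) (Set.Ici 0) := fun i =>
    (ContinuousOn.add (by fun_prop) (continuousOn_finsetSum _ fun j _ =>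
      ((((hI j).2.comp (hc i) (hrange i))).pow 2).mul continuousOn_const))
  have fcont : ∀ i, ContinuousOn (fun y => y * P i / D i y) (Set.Ici 0) := fun i =>
    ContinuousOn.div (by fun_prop) (Dcont i) (fun y _ => (Dpos i y).ne')
  have fint : ∀ i a b, 0 ≤ a → 0 ≤ b →
      IntervalIntegrable (fun y => y * P i / D i y) MeasureTheory.volume a b := by
    intro i a b ha hb
    apply ContinuousOn.intervalIntegrable
    apply (fcont i).mono
    intro y hy
    exact (le_min ha hb).trans hy.1
  have hstep : ∀ i s t, 0 ≤ s → s ≤ t →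
      R i (c i t) - R i (c i s) ≤ ((c i t)^2 * P i - (c i s)^2 * P i) / G s / 2 := by
    intro i s t hs hst
    have hcs := cnn i s hs
    have hct := cnn i t (hs.trans hst)
    rcases le_or_gt (ψ i (h i)) s with hle | hlt
    · have e : c i t = c i s := by
        simp only [hcdef, min_eq_right hle, min_eq_right (hle.trans hst)]
      rw [e]; simp
    rw [hR, hR, intervalIntegral.integral_interval_sub_left (fint i _ _ le_rfl hct)
      (fint i _ _ le_rfl hcs)]
    have hsm : s ∈ Set.Ico (0:ℝ) 1 := ⟨hs, hlt.trans (hx i).2⟩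
    have hbd : ∀ y ∈ Set.Icc (c i s) (c i t), y * P i / D i y ≤ y * (P i / G s) := by
      intro y hy
      have hy0 : 0 ≤ y := hcs.trans hy.1
      rw [← mul_div_assoc]
      refine div_le_div_of_nonneg_left (mul_nonneg hy0 (hP i).le) (Gpos s) ?_
      have hcis : ψ i (c i s) = s := by
        simp only [hcdef, min_eq_left hlt.le]
        exact (hinv i s hsm).2
      have hsy : s ≤ ψ i y := by
        rw [← hcis]; exact (hm i).monotoneOn hcs hy0 hy.1
      rw [Deq i y hy0]
      simp only [hGdef]
      gcongr
      refine (Finset.sum_le_sum fun j _ => ?_).trans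
        (Finset.sum_le_sum_of_subset_of_nonneg (Finset.subset_univ S)
          fun j _ _ => mul_nonneg (sq_nonneg _) (hP j).le)
      have : c j s ≤ inv j (ψ i y) :=
        (hI j).1 (hmin j s hs) (hrange i y hy0) ((min_le_left _ _).trans hsy)
      have h1 := cnn j s hs
      have h2 := (hP j).le
      gcongr
    have := intervalIntegral.integral_mono_on (cmono i s t hs hst) (fint i _ _ hcs hct)
      (Continuous.intervalIntegrable (by fun_prop) _ _) hbd
    refine this.trans (le_of_eq ?_)
    rw [intervalIntegral.integral_mul_const, integral_id]
    ring
  have hfin := aux_log G (fun t => 2 * ∑ i ∈ S, R i (c i t)) Gcont (fun t _ => Gpos t)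
    (by
      intro s t hs hst
      have := Finset.sum_le_sum fun i (_ : i ∈ S) => hstep i s t hs hst
      rw [Finset.sum_sub_distrib, ← Finset.sum_div, ← Finset.sum_div,
        Finset.sum_sub_distrib] at this
      have e : G t - G s = ∑ i ∈ S, (c i t)^2 * P i - ∑ i ∈ S, (c i s)^2 * P i := by
        simp only [hGdef]; ring
      rw [e]
      linarith) Gmono 0 1 le_rfl zero_le_one
  have hR0 : ∀ i, R i 0 = 0 := fun i => by rw [hR]; simp
  simp only [hGdef, c0, c1, hR0] at hfin
  simp at hfin
  linarith

theorem multiuser_continuous_rate_allocation_outage_free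
    (N : ℕ) (hN : 1 ≤ N)
    (ψ inv : Fin N → ℝ → ℝ) (P : Fin N → ℝ)
    (hP : ∀ i, 0 < P i)
    (hc : ∀ i, ContinuousOn (ψ i) (Set.Ici 0))
    (hm : ∀ i, StrictMonoOn (ψ i) (Set.Ici 0))
    (h0 : ∀ i, ψ i 0 = 0)
    (ht : ∀ i, Filter.Tendsto (ψ i) Filter.atTop (nhds 1))
    (hrange : ∀ i, ∀ h ∈ Set.Ici (0:ℝ), ψ i h ∈ Set.Ico (0:ℝ) 1)
    (hinv : ∀ i, ∀ x ∈ Set.Ico (0:ℝ) 1, 0 ≤ inv i x ∧ ψ i (inv i x) = x)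
    (hinv' : ∀ i, ∀ h ∈ Set.Ici (0:ℝ), inv i (ψ i h) = h)
    (R : Fin N → ℝ → ℝ)
    (hR : ∀ i h, R i h =
      ∫ y in (0:ℝ)..h, y * P i /
        (1 + y^2 * P i + ∑ j ∈ Finset.univ.erase i, (inv j (ψ i y))^2 * P j)) :
    ∀ S : Finset (Fin N), ∀ h : Fin N → ℝ, (∀ i ∈ S, 0 ≤ h i) →
      ∑ i ∈ S, R i (h i) ≤
        (1/2) * Real.log (1 + ∑ i ∈ S, (h i)^2 * P i) := by
  intro S h hh
  have := aux_main N ψ inv P hP hc hm h0 hrange hinv hinv' R hR S (fun i => max (h i) 0)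
    (fun i => le_max_right _ _)
  have e1 : ∑ i ∈ S, R i (max (h i) 0) = ∑ i ∈ S, R i (h i) :=
    Finset.sum_congr rfl fun i hi => by rw [max_eq_left (hh i hi)]
  have e2 : ∑ i ∈ S, (max (h i) 0)^2 * P i = ∑ i ∈ S, (h i)^2 * P i :=
    Finset.sum_congr rfl fun i hi => by rw [max_eq_left (hh i hi)]
  simp only [e1, e2] at this
  exact this
end

section
/- Let N ≥ 1, K ≥ 1, P_1, …, P_N > 0, and for each i ∈ {1, …, N} let (h_{i,0} ≤ h_{i,1} ≤ … ≤ h_{i,K−1}) be a nondecreasing sequence of nonnegative reals. Let r_{i,l} be reals such that: (i) for every subset S ⊆ {1, …, N}, ∑_{i∈S} r_{i,0} ≤ (1/2)log(1 + ∑_{i∈S} h_{i,0}² P_i), with equality when S = {1, …, N}; and (ii) for every 1 ≤ l ≤ K−1 and every 0 ≤ k ≤ N, ∑_{j=1}^{k} r_{j,l} + ∑_{j=k+1}^{N} r_{j,l−1} = (1/2)log(1 + ∑_{j=1}^{k} h_{j,l}² P_j + ∑_{j=k+1}^{N} h_{j,l−1}² P_j). Then for every subset S ⊆ {1, …, N}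 and every choice of levels l_i ∈ {0, …, K−1} for i ∈ S, ∑_{i∈S} r_{i,l_i} ≤ (1/2)log(1 + ∑_{i∈S} h_{i,l_i}² P_i). -/
theorem aux_log_s15 (A B x y : ℝ) (hB : 0 ≤ B) (hAB : B ≤ A) (hx : 0 ≤ x) (hxy : x ≤ y) :
    Real.log (1 + (A + y)) - Real.log (1 + (A + x)) ≤
      Real.log (1 + (B + y)) - Real.log (1 + (B + x)) := by
  have h1 : Real.log ((1 + (A + y)) * (1 + (B + x))) ≤
      Real.log ((1 + (B + y)) * (1 + (A + x))) := by
    apply Real.log_le_log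
    · apply mul_pos <;> linarith
    · nlinarith [mul_nonneg (sub_nonneg.2 hAB) (sub_nonneg.2 hxy)]
  rw [Real.log_mul (by linarith) (by linarith), Real.log_mul (by linarith) (by linarith)] at h1
  linarith

theorem multiuser_discrete_rate_allocation_outage_free
    (N K : ℕ) (hN : 1 ≤ N) (hK : 1 ≤ K)
    (P : ℕ → ℝ) (hP : ∀ i < N, 0 < P i)
    (h : ℕ → ℕ → ℝ)
    (hh0 : ∀ i < N, 0 ≤ h i 0)
    (hhmono : ∀ i < N, ∀ l, l + 1 < K → h i l ≤ h i (l + 1))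
    (r : ℕ → ℕ → ℝ)
    (hbase : ∀ S ⊆ Finset.range N,
      ∑ i ∈ S, r i 0 ≤ (1/2) * Real.log (1 + ∑ i ∈ S, (h i 0)^2 * P i))
    (hbase_eq : ∑ i ∈ Finset.range N, r i 0 =
      (1/2) * Real.log (1 + ∑ i ∈ Finset.range N, (h i 0)^2 * P i))
    (hstep : ∀ l, 1 ≤ l → l < K → ∀ k ≤ N,
      ∑ j ∈ Finset.range k, r j l + ∑ j ∈ Finset.Ico k N, r j (l - 1) =
        (1/2) * Real.log (1 + ∑ j ∈ Finset.range k, (h j l)^2 * P j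
          + ∑ j ∈ Finset.Ico k N, (h j (l - 1))^2 * P j)) :
    ∀ S ⊆ Finset.range N, ∀ lev : ℕ → ℕ, (∀ i ∈ S, lev i < K) →
      ∑ i ∈ S, r i (lev i) ≤
        (1/2) * Real.log (1 + ∑ i ∈ S, (h i (lev i))^2 * P i) := by
  have hnn : ∀ i < N, ∀ l < K, 0 ≤ h i l := by
    intro i hi l
    induction l with
    | zero => intro _; exact hh0 i hi
    | succ l ih => intro hl; exact (ih (by omega)).trans (hhmono i hi l hl)
  have hmono : ∀ i < N, ∀ m < K, ∀ l ≤ m, h i l ≤ h i m := by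
    intro i hi m
    induction m with
    | zero => intro _ l hl; rw [Nat.le_zero.1 hl]
    | succ m ih =>
      intro hm l hl
      rcases Nat.lt_or_ge m l with h1 | h1
      · rw [show l = m + 1 by omega]
      · exact (ih (by omega) l h1).trans (hhmono i hi m hm)
  obtain ⟨a, ha⟩ : ∃ a : ℕ → ℕ → ℝ, ∀ i l, (h i l)^2 * P i = a i l := ⟨_, fun _ _ => rfl⟩
  have ann : ∀ i < N, ∀ l, 0 ≤ a i l := by
    intro i hi l
    rw [← ha]
    exact mul_nonneg (sq_nonneg _) (hP i hi).le
  have amono : ∀ i < N, ∀ m < K, ∀ l ≤ m, a i l ≤ a i m := by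
    intro i hi m hm l hl
    rw [← ha, ← ha]
    exact mul_le_mul_of_nonneg_right
      (pow_le_pow_left₀ (hnn i hi l (by omega)) (hmono i hi m hm l hl) 2) (hP i hi).le
  simp only [ha] at *
  have key : ∀ n : ℕ, ∀ S ⊆ Finset.range N, ∀ lev : ℕ → ℕ, (∀ i ∈ S, lev i < K) →
      ∑ i ∈ S, lev i = n →
      ∑ i ∈ S, r i (lev i) ≤ (1/2) * Real.log (1 + ∑ i ∈ S, a i (lev i)) := by
    intro n
    induction n with
    | zero =>
      intro S hS lev _ h0
      have h0 : ∀ i ∈ S, lev i = 0 := by simpa using h0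
      rw [Finset.sum_congr rfl (fun i hi => by rw [h0 i hi] : ∀ i ∈ S, r i (lev i) = r i 0),
        Finset.sum_congr rfl (fun i hi => by rw [h0 i hi] : ∀ i ∈ S, a i (lev i) = a i 0)]
      exact hbase S hS
    | succ n ih =>
      intro S hS lev hlev hsum
      have hne : S.Nonempty := by
        rw [Finset.nonempty_iff_ne_empty]
        rintro rfl
        simp at hsum
      obtain ⟨k, hk, hmax⟩ := Finset.exists_max_image S (fun i => toLex (lev i, i)) hne
      have hmax' : ∀ i ∈ S, lev i < lev k ∨ (lev i = lev k ∧ i ≤ k) := by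
        intro i hi
        simpa [Prod.Lex.toLex_le_toLex] using hmax i hi
      have hkpos : 1 ≤ lev k := by
        by_contra hc
        have : ∑ i ∈ S, lev i = 0 := by
          apply Finset.sum_eq_zero
          intro i hi
          have := hmax' i hi
          omega
        omega
      obtain ⟨l, hl⟩ : ∃ l, lev k = l + 1 := ⟨lev k - 1, by omega⟩
      have hkN : k < N := Finset.mem_range.1 (hS hk)
      have hlK : l + 1 < K := hl ▸ hlev k hk
      have e1 := hstep (l + 1) (by omega) hlK k hkN.le
      have e2 := hstep (l + 1) (by omega) hlK (k + 1) hkN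
      simp only [Nat.add_sub_cancel] at e1 e2
      rw [Finset.sum_eq_sum_Ico_succ_bot hkN, Finset.sum_eq_sum_Ico_succ_bot hkN] at e1
      rw [Finset.sum_range_succ, Finset.sum_range_succ] at e2
      have hA : ∑ i ∈ S.erase k, a i (lev i) ≤
          ∑ j ∈ Finset.range k, a j (l + 1) + ∑ j ∈ Finset.Ico (k + 1) N, a j l := by
        have hd : Disjoint (Finset.range k) (Finset.Ico (k + 1) N) := by
          rw [Finset.disjoint_left]
          intro i hi hi'
          simp at hi hi'
          omega
        let g : ℕ → ℝ := fun j => if j < k then a j (l + 1) else a j l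
        have g1 : ∑ j ∈ Finset.range k, a j (l + 1) = ∑ j ∈ Finset.range k, g j := by
          apply Finset.sum_congr rfl
          intro j hj
          simp [g, Finset.mem_range.1 hj]
        have g2 : ∑ j ∈ Finset.Ico (k + 1) N, a j l = ∑ j ∈ Finset.Ico (k + 1) N, g j := by
          apply Finset.sum_congr rfl
          intro j hj
          have : ¬ j < k := by
            have := Finset.mem_Ico.1 hj
            omega
          simp [g, this]
        rw [g1, g2, ← Finset.sum_union hd]
        refine (Finset.sum_le_sum (g := g) ?_).trans
          (Finset.sum_le_sum_of_subset_of_nonneg ?_ ?_)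
        · intro i hi
          have hi2 := Finset.mem_erase.1 hi
          have hiN := Finset.mem_range.1 (hS hi2.2)
          have := hmax' i hi2.2
          by_cases hik : i < k
          · simp only [g, hik, if_true]
            exact amono i hiN _ hlK _ (by omega)
          · simp only [g, hik, if_false]
            exact amono i hiN _ (by omega) _ (by omega)
        · intro i hi
          have hi2 := Finset.mem_erase.1 hi
          have hiN := Finset.mem_range.1 (hS hi2.2)
          simp only [Finset.mem_union, Finset.mem_range, Finset.mem_Ico]
          omega
        · intro i hi _
          have hiN : i < N := by
            simp only [Finset.mem_union, Finset.mem_range, Finset.mem_Ico] at hi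
            omega
          simp only [g]
          split_ifs
          · exact ann i hiN _
          · exact ann i hiN _
      have hB : 0 ≤ ∑ i ∈ S.erase k, a i (lev i) := by
        apply Finset.sum_nonneg
        intro i hi
        exact ann i (Finset.mem_range.1 (hS (Finset.mem_of_mem_erase hi))) _
      have hupd : ∀ i ∈ S.erase k, Function.update lev k l i = lev i := by
        intro i hi
        exact Function.update_of_ne (Finset.ne_of_mem_erase hi) _ _
      have hI := ih S hS (Function.update lev k l) (by
        intro i hi
        by_cases hik : i = k
        · subst hik
          rw [Function.update_self]
          omega
        · rw [Function.update_of_ne hik]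
          exact hlev i hi) (by
        have q1 : lev k + ∑ i ∈ S.erase k, lev i = ∑ i ∈ S, lev i :=
          Finset.add_sum_erase S lev hk
        have q3 : ∑ i ∈ S.erase k, Function.update lev k l i = ∑ i ∈ S.erase k, lev i :=
          Finset.sum_congr rfl hupd
        have q2 : Function.update lev k l k + ∑ i ∈ S.erase k, Function.update lev k l i =
            ∑ i ∈ S, Function.update lev k l i :=
          Finset.add_sum_erase S (Function.update lev k l) hk
        rw [q3, Function.update_self] at q2
        omega)
      rw [← Finset.add_sum_erase S _ hk, ← Finset.add_sum_erase S _ hk,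
        Finset.sum_congr rfl (fun i hi => by rw [hupd i hi] :
          ∀ i ∈ S.erase k, r i (Function.update lev k l i) = r i (lev i)),
        Finset.sum_congr rfl (fun i hi => by rw [hupd i hi] :
          ∀ i ∈ S.erase k, a i (Function.update lev k l i) = a i (lev i)),
        Function.update_self] at hI
      rw [← Finset.add_sum_erase S _ hk, ← Finset.add_sum_erase S _ hk, hl]
      have hlog := aux_log_s15 _ _ (a k l) (a k (l + 1)) hB hA (ann k hkN _)
        (amono k hkN _ hlK _ (by omega))
      generalize ∑ i ∈ S.erase k, a i (lev i) = B at *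
      generalize ∑ j ∈ Finset.range k, a j (l + 1) = A1 at *
      generalize ∑ j ∈ Finset.Ico (k + 1) N, a j l = A2 at *
      rw [show 1 + A1 + (a k l + A2) = 1 + (A1 + A2 + a k l) by ring] at e1
      rw [show 1 + (A1 + a k (l + 1)) + A2 = 1 + (A1 + A2 + a k (l + 1)) by ring] at e2
      rw [show a k l + B = B + a k l by ring] at hI
      rw [show a k (l + 1) + B = B + a k (l + 1) by ring]
      linarith
  intro S hS lev hlev
  exact key _ S hS lev hlev rfl
end

section
/- Let μ1, μ2 be probability measures on [0,∞), P1, P2 > 0 and α ∈ (0,1). Let ν2 = α·μ2 + (1−α)·δ_0, where δ_0 is the Dirac measure at 0. Then the supremum of ∫ R1 dμ1 + α ∫ R2 dμ2 over all pairs (R1, R2) outage-free for (μ1, μ2, P1, P2) equals the supremum of ∫ R1 dμ1 + ∫ R2 dν2 over all pairs (R1, R2) outage-free for (μ1, ν2, P1, P2). -/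
open MeasureTheory

theorem msupport_nonempty (μ : Measure ℝ) [IsProbabilityMeasure μ] :
    ∃ x, x ∈ msupport μ := by
  by_contra hcon
  push Not at hcon
  have h : μ Set.univ = 0 := by
    apply measure_null_of_locally_null
    intro x _
    have hx := hcon x
    simp only [msupport, Set.mem_setOf_eq, not_forall, not_not] at hx
    obtain ⟨U, hU, h0⟩ := hx
    exact ⟨U, by simpa using hU, h0⟩
  simp at h

theorem mem_msupport_mix (μ : Measure ℝ) (α : ℝ) (hα : α ∈ Set.Ioo (0:ℝ) 1) (x : ℝ) :
    x ∈ msupport (ENNReal.ofReal α • μ + ENNReal.ofReal (1 - α) • Measure.dirac 0) ↔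
      x ∈ msupport μ ∨ x = 0 := by
  have h1 : ¬ (α ≤ 0) := not_le.mpr hα.1
  have h2 : ¬ (1 ≤ α) := not_le.mpr hα.2
  constructor
  · intro hx
    by_contra hcon
    push Not at hcon
    obtain ⟨hs, hx0⟩ := hcon
    simp only [msupport, Set.mem_setOf_eq, not_forall, not_not] at hs
    obtain ⟨U, hU, h0⟩ := hs
    have hV : U ∩ {0}ᶜ ∈ nhds x :=
      Filter.inter_mem hU (isOpen_compl_singleton.mem_nhds hx0)
    apply hx _ hV
    have : μ (U ∩ {0}ᶜ) = 0 := measure_mono_null Set.inter_subset_left h0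
    simp [this]
  · rintro (hx | rfl) U hU
    · have := hx U hU
      simp [this, h1]
    · have := mem_of_mem_nhds hU
      simp [this, h2]

theorem integral_mix (μ : Measure ℝ) (α : ℝ) (hα : α ∈ Set.Ioo (0:ℝ) 1)
    (R : ℝ → ℝ) (hR : R 0 = 0) :
    ∫ x, R x ∂(ENNReal.ofReal α • μ + ENNReal.ofReal (1 - α) • Measure.dirac 0) =
      α * ∫ x, R x ∂μ := by
  have hα0 : ENNReal.ofReal α ≠ 0 := by simpa using hα.1
  by_cases hi : Integrable R μ
  · rw [integral_add_measure (hi.smul_measure ENNReal.ofReal_ne_top)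
      ((integrable_dirac (by simp)).smul_measure ENNReal.ofReal_ne_top),
      integral_smul_measure, integral_smul_measure, integral_dirac, hR,
      ENNReal.toReal_ofReal hα.1.le]
    simp
  · rw [integral_undef hi, integral_undef]
    · simp
    · intro h
      exact hi ((integrable_smul_measure hα0 ENNReal.ofReal_ne_top).1 h.left_of_add_measure)

theorem weighted_sum_capacity_as_modified_sum_capacity
    (μ1 μ2 : Measure ℝ) [IsProbabilityMeasure μ1] [IsProbabilityMeasure μ2]
    (hsupp1 : μ1 (Set.Iio 0) = 0) (hsupp2 : μ2 (Set.Iio 0) = 0)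
    (P1 P2 : ℝ) (hP1 : 0 < P1) (hP2 : 0 < P2)
    (α : ℝ) (hα : α ∈ Set.Ioo (0:ℝ) 1) :
    sSup {v : ℝ | ∃ R1 R2 : ℝ → ℝ, OutageFree μ1 μ2 P1 P2 R1 R2 ∧
        v = (∫ x, R1 x ∂μ1) + α * (∫ x, R2 x ∂μ2)} =
    sSup {v : ℝ | ∃ R1 R2 : ℝ → ℝ,
        OutageFree μ1
          (ENNReal.ofReal α • μ2 + ENNReal.ofReal (1 - α) • Measure.dirac 0)
          P1 P2 R1 R2 ∧
        v = (∫ x, R1 x ∂μ1) +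
          (∫ x, R2 x
            ∂(ENNReal.ofReal α • μ2 + ENNReal.ofReal (1 - α) • Measure.dirac 0))} := by
  congr 1
  ext v
  obtain ⟨a0, ha0⟩ := msupport_nonempty μ1
  obtain ⟨b0, hb0⟩ := msupport_nonempty μ2
  constructor
  · rintro ⟨R1, R2, ⟨m1, m2, p1, p2, h⟩, rfl⟩
    refine ⟨R1, fun x => if x = 0 then 0 else R2 x, ⟨m1, ?_, p1, ?_, ?_⟩, ?_⟩
    · exact Measurable.ite (measurable_subtype_coe (measurableSet_singleton (0:ℝ)))
        measurable_const m2
    · intro x hx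
      dsimp only
      split_ifs
      · exact le_rfl
      · exact p2 x hx
    · intro a ha b hb
      rw [mem_msupport_mix μ2 α hα] at hb
      by_cases hb' : b = 0
      · have := (h a ha b0 hb0).1
        subst hb'
        simpa using this
      · simpa [hb'] using h a ha b (hb.resolve_right hb')
    · rw [integral_mix μ2 α hα _ (by simp)]
      congr 2
      by_cases h0 : (0:ℝ) ∈ msupport μ2
      · have h1 : R2 0 ≤ 0 := by simpa using (h a0 ha0 0 h0).2.1
        have h2 : R2 0 = 0 := le_antisymm h1 (p2 0 (by simp))
        congr 1
        ext x
        split_ifs with hx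
        · rw [hx, h2]
        · rfl
      · simp only [msupport, Set.mem_setOf_eq, not_forall, not_not] at h0
        obtain ⟨U, hU, hU0⟩ := h0
        apply integral_congr_ae
        have : ∀ᵐ x ∂μ2, x ∉ U := measure_eq_zero_iff_ae_notMem.1 hU0
        filter_upwards [this] with x hx
        have : x ≠ 0 := by
          rintro rfl
          exact hx (mem_of_mem_nhds hU)
        simp [this]
  · rintro ⟨R1, R2, ⟨m1, m2, p1, p2, h⟩, rfl⟩
    have h1 : R2 0 ≤ 0 := by
      simpa using (h a0 ha0 0 ((mem_msupport_mix μ2 α hα 0).2 (Or.inr rfl))).2.1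
    have h2 : R2 0 = 0 := le_antisymm h1 (p2 0 (by simp))
    refine ⟨R1, R2, ⟨m1, m2, p1, p2, ?_⟩, ?_⟩
    · intro a ha b hb
      exact h a ha b ((mem_msupport_mix μ2 α hα b).2 (Or.inl hb))
    · rw [integral_mix μ2 α hα _ h2]
end

section
/- Consider two users where user i ∈ {1, 2} has finitely many fading states 0 < h_{i,1} < … < h_{i,k_i} with probabilities p_{i,j} > 0 summing to 1, an average power budget Pav_i > 0, and fix a weight α ∈ [0,1]. A feasible power allocation is a pair of vectors P_i = (P_{i,1}, …, P_{i,k_i}) of nonnegative reals with ∑_j p_{i,j} P_{i,j} ≤ Pav_i for i = 1, 2. For a feasible power allocation, let V(P_1, P_2) be the supremum of ∑_j p_{1,j} r_{1,j} + α ∑_k p_{2,k} r_{2,k} over nonnegative reals r_{1,j}, r_{2,k} satisfying, for every j and k: r_{1,j} ≤ (1/2)log(1 + h_{1,j}² P_{1,j}), r_{2,k} ≤ (1/2)log(1 + h_{2,k}² P_{2,k}), and r_{1,j} + r_{2,k} ≤ (1/2)log(1 + h_{1,j}² P_{1,j} + h_{2,k}² P_{2,k}). Then there exists a feasible power allocation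 (P_1*, P_2*) that maximizes V over all feasible power allocations and such that, for i = 1, 2, the received powers h_{i,j}² P*_{i,j} are nondecreasing in j. -/
/-- A power allocation `P` for a user with `k` fading states having
probabilities `p` is feasible if it is nonnegative and respects the
average power budget `Pav`. -/
def FeasiblePower (k : ℕ) (p : ℕ → ℝ) (Pav : ℝ) (P : ℕ → ℝ) : Prop :=
  (∀ j < k, 0 ≤ P j) ∧ ∑ j ∈ Finset.range k, p j * P j ≤ Pav

/-- The `(1, α)`-weighted adaptive sum-capacity of the two-user discrete
individual-CSI Gaussian MAC under the power allocation `(P1, P2)`. -/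
noncomputable def weightedAdaptiveSumCapacity
    (k1 k2 : ℕ) (h1 h2 p1 p2 : ℕ → ℝ) (α : ℝ) (P1 P2 : ℕ → ℝ) : ℝ :=
  sSup {v : ℝ | ∃ r1 r2 : ℕ → ℝ,
    (∀ j < k1, 0 ≤ r1 j) ∧ (∀ k < k2, 0 ≤ r2 k) ∧
    (∀ j < k1, r1 j ≤ (1/2) * Real.log (1 + (h1 j)^2 * P1 j)) ∧
    (∀ k < k2, r2 k ≤ (1/2) * Real.log (1 + (h2 k)^2 * P2 k)) ∧
    (∀ j < k1, ∀ k < k2,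
      r1 j + r2 k ≤ (1/2) * Real.log (1 + (h1 j)^2 * P1 j + (h2 k)^2 * P2 k)) ∧
    v = ∑ j ∈ Finset.range k1, p1 j * r1 j
        + α * ∑ k ∈ Finset.range k2, p2 k * r2 k}

lemma sum_two_change (k : ℕ) (g g' : ℕ → ℝ) (i j : ℕ) (hij : i ≠ j) (hi : i < k) (hj : j < k)
    (h : ∀ l, l ≠ i → l ≠ j → g' l = g l) :
    ∑ l ∈ Finset.range k, g' l = ∑ l ∈ Finset.range k, g l + (g' i + g' j - g i - g j) := by
  have h1 : ∑ l ∈ Finset.range k, (g' l - g l) = ∑ l ∈ ({i, j} : Finset ℕ), (g' l - g l) := by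
    symm
    apply Finset.sum_subset
    · intro x hx
      simp only [Finset.mem_insert, Finset.mem_singleton] at hx
      rcases hx with rfl | rfl <;> simpa
    · intro x _ hx
      simp only [Finset.mem_insert, Finset.mem_singleton, not_or] at hx
      rw [h x hx.1 hx.2, sub_self]
  rw [Finset.sum_pair hij, Finset.sum_sub_distrib] at h1
  linarith

/-- Averaging two received powers (and rates) that are in the wrong order. -/
lemma averaging_step (k : ℕ) (h p P r : ℕ → ℝ)
    (hpos : ∀ j < k, 0 < h j) (hmono : ∀ i j, i < j → j < k → h i < h j)
    (hp : ∀ j < k, 0 < p j) (hP : ∀ j < k, 0 ≤ P j) (hr : ∀ j < k, 0 ≤ r j)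
    (i j : ℕ) (hij : i < j) (hj : j < k) (hbad : (h j)^2 * P j < (h i)^2 * P i) :
    ∃ P' r' : ℕ → ℝ, (∀ j < k, 0 ≤ P' j) ∧ (∀ j < k, 0 ≤ r' j) ∧
      ∑ l ∈ Finset.range k, p l * P' l < ∑ l ∈ Finset.range k, p l * P l ∧
      ∑ l ∈ Finset.range k, p l * r' l = ∑ l ∈ Finset.range k, p l * r l ∧
      ∀ C t : ℝ, (∀ l < k, Real.exp (2 * (r l + t)) ≤ 1 + (h l)^2 * P l + C) →
        ∀ l < k, Real.exp (2 * (r' l + t)) ≤ 1 + (h l)^2 * P' l + C := by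
  have hi : i < k := hij.trans hj
  have hpi := hp i hi
  have hpj := hp j hj
  have hhi := hpos i hi
  have hhj := hpos j hj
  have hhij := hmono i j hij hj
  have hs : 0 < p i + p j := by linarith
  set a := p i / (p i + p j) with ha
  set b := p j / (p i + p j) with hb
  have ha0 : 0 < a := by positivity
  have hb0 : 0 < b := by positivity
  have hab : a + b = 1 := by rw [ha, hb]; field_simp
  have hpa : p i = (p i + p j) * a := by rw [ha]; field_simp
  have hpb : p j = (p i + p j) * b := by rw [hb]; field_simp
  set s := p i + p j with hsdef
  set x := (h i)^2 * P i with hx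
  set y := (h j)^2 * P j with hy
  have hx0 : 0 ≤ x := mul_nonneg (by positivity) (hP i hi)
  have hy0 : 0 ≤ y := mul_nonneg (by positivity) (hP j hj)
  set m := a * x + b * y with hm
  have hm0 : 0 ≤ m := by positivity
  set ρ := a * r i + b * r j with hρ
  have hri := hr i hi
  have hrj := hr j hj
  have hρ0 : 0 ≤ ρ := by positivity
  have hji : j ≠ i := hij.ne'
  have key : ∀ C t : ℝ, (∀ l < k, Real.exp (2 * (r l + t)) ≤ 1 + (h l)^2 * P l + C) →
      Real.exp (2 * (ρ + t)) ≤ 1 + m + C := by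
    intro C t H
    have e1 := H i hi
    have e2 := H j hj
    have hc := convexOn_exp.2 (Set.mem_univ (2 * (r i + t))) (Set.mem_univ (2 * (r j + t)))
      ha0.le hb0.le hab
    simp only [smul_eq_mul] at hc
    have e3 : 2 * (ρ + t) = a * (2 * (r i + t)) + b * (2 * (r j + t)) := by
      rw [hρ]; linear_combination (-2 * t) * hab
    have e4 : 1 + m + C = a * (1 + x + C) + b * (1 + y + C) := by
      rw [hm]; linear_combination (-(1 + C)) * hab
    rw [e3, e4]
    exact hc.trans (add_le_add (mul_le_mul_of_nonneg_left e1 ha0.le)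
      (mul_le_mul_of_nonneg_left e2 hb0.le))
  refine ⟨fun l => if l = i then m / (h i)^2 else if l = j then m / (h j)^2 else P l,
    fun l => if l = i then ρ else if l = j then ρ else r l, ?_, ?_, ?_, ?_, ?_⟩
  · intro l hl
    dsimp only
    split_ifs
    · positivity
    · positivity
    · exact hP l hl
  · intro l hl
    dsimp only
    split_ifs
    · exact hρ0
    · exact hρ0
    · exact hr l hl
  · rw [sum_two_change k (fun l => p l * P l) _ i j hij.ne hi hj
      (by intro l h1 h2; simp [h1, h2])]
    simp only [if_true, if_neg hji]
    have ePi : P i = x / (h i)^2 := by rw [hx]; field_simp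
    have ePj : P j = y / (h j)^2 := by rw [hy]; field_simp
    have hinv : 1 / (h j)^2 < 1 / (h i)^2 := by
      apply one_div_lt_one_div_of_lt (by positivity)
      exact pow_lt_pow_left₀ hhij hhi.le (by norm_num)
    have e : p i * (m / (h i)^2) + p j * (m / (h j)^2) - p i * P i - p j * P j
        = s * a * b * (x - y) * (1 / (h j)^2 - 1 / (h i)^2) := by
      rw [ePi, ePj, hpa, hpb, hm]
      have : b = 1 - a := by linarith
      rw [this]; ring
    rw [e]
    have : s * a * b * (x - y) * (1 / (h j)^2 - 1 / (h i)^2) < 0 :=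
      mul_neg_of_pos_of_neg (mul_pos (by positivity) (by linarith)) (by linarith)
    linarith
  · rw [sum_two_change k (fun l => p l * r l) _ i j hij.ne hi hj
      (by intro l h1 h2; simp [h1, h2])]
    simp only [if_true, if_neg hji]
    have : p i * ρ + p j * ρ - p i * r i - p j * r j = 0 := by
      rw [hpa, hpb, hρ]
      have : b = 1 - a := by linarith
      rw [this]; ring
    linarith
  · intro C t H l hl
    have K := key C t H
    dsimp only
    split_ifs with c1 c2
    · rw [c1, mul_div_cancel₀ _ (by positivity)]; exact K
    · rw [c2, mul_div_cancel₀ _ (by positivity)]; exact K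
    · exact H l hl

/-- The rate constraints, written with exponentials. -/
def GoodTuple (k1 k2 : ℕ) (h1 h2 p1 p2 : ℕ → ℝ) (A1 A2 : ℝ) (P1 P2 r1 r2 : ℕ → ℝ) : Prop :=
  FeasiblePower k1 p1 A1 P1 ∧ FeasiblePower k2 p2 A2 P2 ∧
  (∀ j < k1, 0 ≤ r1 j) ∧ (∀ k < k2, 0 ≤ r2 k) ∧
  (∀ j < k1, Real.exp (2 * r1 j) ≤ 1 + (h1 j)^2 * P1 j) ∧
  (∀ k < k2, Real.exp (2 * r2 k) ≤ 1 + (h2 k)^2 * P2 k) ∧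
  (∀ j < k1, ∀ k < k2,
    Real.exp (2 * (r1 j + r2 k)) ≤ 1 + (h1 j)^2 * P1 j + (h2 k)^2 * P2 k)

lemma le_half_log_iff (r z : ℝ) (hz : 0 < z) :
    r ≤ (1/2) * Real.log z ↔ Real.exp (2 * r) ≤ z := by
  rw [← Real.le_log_iff_exp_le hz]
  constructor <;> intro h <;> linarith

lemma power_bound (k : ℕ) (p : ℕ → ℝ) (A : ℝ) (P : ℕ → ℝ) (hp : ∀ j < k, 0 < p j)
    (hP : FeasiblePower k p A P) (j : ℕ) (hj : j < k) : P j ≤ |A / p j| := by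
  have h1 : p j * P j ≤ A := by
    refine le_trans ?_ hP.2
    exact Finset.single_le_sum (f := fun l => p l * P l)
      (fun l hl => mul_nonneg (hp l (by simpa using hl)).le (hP.1 l (by simpa using hl)))
      (by simpa using hj)
  refine le_trans ?_ (le_abs_self _)
  rw [le_div_iff₀ (hp j hj)]
  linarith

lemma rate_bound (r z w : ℝ) (h : Real.exp (2 * r) ≤ 1 + z) (hr : 0 ≤ r) (hzw : z ≤ w) :
    r ≤ 1 + w := by
  have := Real.add_one_le_exp (2 * r)
  linarith

/-- Two power allocations and two rate vectors. -/
abbrev RateTuple : Type := (ℕ → ℝ) × (ℕ → ℝ) × (ℕ → ℝ) × (ℕ → ℝ)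

/-- There is a lexicographic optimum: maximal value, and then minimal power. -/
lemma exists_lex_optimum (k1 k2 : ℕ) (h1 h2 p1 p2 : ℕ → ℝ) (A1 A2 α : ℝ)
    (hA1 : 0 < A1) (hA2 : 0 < A2)
    (hp1 : ∀ j < k1, 0 < p1 j) (hp2 : ∀ j < k2, 0 < p2 j) :
    ∃ P1 P2 r1 r2, GoodTuple k1 k2 h1 h2 p1 p2 A1 A2 P1 P2 r1 r2 ∧
      ∀ Q1 Q2 s1 s2, GoodTuple k1 k2 h1 h2 p1 p2 A1 A2 Q1 Q2 s1 s2 →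
        (∑ j ∈ Finset.range k1, p1 j * s1 j + α * ∑ j ∈ Finset.range k2, p2 j * s2 j ≤
          ∑ j ∈ Finset.range k1, p1 j * r1 j + α * ∑ j ∈ Finset.range k2, p2 j * r2 j) ∧
        (∑ j ∈ Finset.range k1, p1 j * s1 j + α * ∑ j ∈ Finset.range k2, p2 j * s2 j =
          ∑ j ∈ Finset.range k1, p1 j * r1 j + α * ∑ j ∈ Finset.range k2, p2 j * r2 j →
         ∑ j ∈ Finset.range k1, p1 j * P1 j + ∑ j ∈ Finset.range k2, p2 j * P2 j ≤
          ∑ j ∈ Finset.range k1, p1 j * Q1 j + ∑ j ∈ Finset.range k2, p2 j * Q2 j) := by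
  let box : (ℕ → ℝ) → Set (ℕ → ℝ) := fun B => Set.pi Set.univ (fun j => Set.Icc 0 (B j))
  have hbox : ∀ B, IsCompact (box B) := fun B => isCompact_univ_pi (fun _ => isCompact_Icc)
  let B1 : ℕ → ℝ := fun j => |A1 / p1 j|
  let B2 : ℕ → ℝ := fun j => |A2 / p2 j|
  let R1 : ℕ → ℝ := fun j => 1 + (h1 j)^2 * B1 j
  let R2 : ℕ → ℝ := fun j => 1 + (h2 j)^2 * B2 j
  let G : Set RateTuple := {z | GoodTuple k1 k2 h1 h2 p1 p2 A1 A2 z.1 z.2.1 z.2.2.1 z.2.2.2}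
  let K : Set RateTuple := (box B1 ×ˢ (box B2 ×ˢ (box R1 ×ˢ box R2))) ∩ G
  have hG : IsClosed G := by
    simp only [G, GoodTuple, FeasiblePower, Set.ofPred_and, Set.ofPred_forall]
    have c1 : ∀ j, Continuous fun z : RateTuple => z.1 j := fun j => by fun_prop
    have c2 : ∀ j, Continuous fun z : RateTuple => z.2.1 j := fun j => by fun_prop
    have c3 : ∀ j, Continuous fun z : RateTuple => z.2.2.1 j := fun j => by fun_prop
    have c4 : ∀ j, Continuous fun z : RateTuple => z.2.2.2 j := fun j => by fun_prop
    refine ((isClosed_iInter fun j => isClosed_iInter fun _ => ?_).inter ?_).inter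
      (((isClosed_iInter fun j => isClosed_iInter fun _ => ?_).inter ?_).inter
      ((isClosed_iInter fun j => isClosed_iInter fun _ => ?_).inter
      ((isClosed_iInter fun j => isClosed_iInter fun _ => ?_).inter
      ((isClosed_iInter fun j => isClosed_iInter fun _ => ?_).inter
      ((isClosed_iInter fun j => isClosed_iInter fun _ => ?_).inter
      (isClosed_iInter fun j => isClosed_iInter fun _ => isClosed_iInter fun l =>
        isClosed_iInter fun _ => ?_))))))
    all_goals exact isClosed_le (by fun_prop) (by fun_prop)
  have hK : IsCompact K :=
    ((hbox B1).prod ((hbox B2).prod ((hbox R1).prod (hbox R2)))).inter_right hG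
  let W : RateTuple → ℝ := fun z =>
    ∑ j ∈ Finset.range k1, p1 j * z.2.2.1 j + α * ∑ j ∈ Finset.range k2, p2 j * z.2.2.2 j
  let D : RateTuple → ℝ := fun z =>
    ∑ j ∈ Finset.range k1, p1 j * z.1 j + ∑ j ∈ Finset.range k2, p2 j * z.2.1 j
  have hW : Continuous W := by fun_prop
  have hD : Continuous D := by fun_prop
  -- truncation
  have trunc : ∀ z ∈ G, ∃ z' ∈ K, W z' = W z ∧ D z' = D z := by
    rintro ⟨Q1, Q2, s1, s2⟩ hz
    obtain ⟨f1, f2, a1, a2, e1, e2, e3⟩ := hz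
    dsimp only at f1 f2 a1 a2 e1 e2 e3
    have S : ∀ (k : ℕ) (p f : ℕ → ℝ), ∑ j ∈ Finset.range k, p j * (if j < k then f j else 0)
        = ∑ j ∈ Finset.range k, p j * f j := by
      intro k p f
      refine Finset.sum_congr rfl fun j hj => ?_
      rw [if_pos (by simpa using hj)]
    have hB1 : ∀ j, 0 ≤ B1 j := fun j => abs_nonneg _
    have hB2 : ∀ j, 0 ≤ B2 j := fun j => abs_nonneg _
    have hR1 : ∀ j, 0 ≤ R1 j := fun j =>
      add_nonneg zero_le_one (mul_nonneg (sq_nonneg _) (hB1 j))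
    have hR2 : ∀ j, 0 ≤ R2 j := fun j =>
      add_nonneg zero_le_one (mul_nonneg (sq_nonneg _) (hB2 j))
    have hb : ∀ (k : ℕ) (f B : ℕ → ℝ), (∀ j, 0 ≤ B j) → (∀ j < k, 0 ≤ f j ∧ f j ≤ B j) →
        (fun j => if j < k then f j else 0) ∈ box B := by
      intro k f B h0 hf j _
      dsimp only
      split_ifs with hj
      · exact hf j hj
      · exact ⟨le_rfl, h0 j⟩
    refine ⟨(fun j => if j < k1 then Q1 j else 0, fun j => if j < k2 then Q2 j else 0,
      fun j => if j < k1 then s1 j else 0, fun j => if j < k2 then s2 j else 0),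
      ⟨⟨?_, ?_, ?_, ?_⟩, ?_⟩, ?_, ?_⟩
    · exact hb _ _ _ hB1 fun j hj => ⟨f1.1 j hj, power_bound k1 p1 A1 Q1 hp1 f1 j hj⟩
    · exact hb _ _ _ hB2 fun j hj => ⟨f2.1 j hj, power_bound k2 p2 A2 Q2 hp2 f2 j hj⟩
    · exact hb _ _ _ hR1 fun j hj => ⟨a1 j hj, rate_bound _ _ _ (e1 j hj) (a1 j hj)
        (mul_le_mul_of_nonneg_left (power_bound k1 p1 A1 Q1 hp1 f1 j hj) (sq_nonneg _))⟩
    · exact hb _ _ _ hR2 fun j hj => ⟨a2 j hj, rate_bound _ _ _ (e2 j hj) (a2 j hj)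
        (mul_le_mul_of_nonneg_left (power_bound k2 p2 A2 Q2 hp2 f2 j hj) (sq_nonneg _))⟩
    · refine ⟨⟨fun j hj => ?_, ?_⟩, ⟨fun j hj => ?_, ?_⟩, fun j hj => ?_, fun j hj => ?_,
        fun j hj => ?_, fun j hj => ?_, fun j hj l hl => ?_⟩
      · simpa only [if_pos hj] using f1.1 j hj
      · exact (S k1 p1 Q1).trans_le f1.2
      · simpa only [if_pos hj] using f2.1 j hj
      · exact (S k2 p2 Q2).trans_le f2.2
      · simpa only [if_pos hj] using a1 j hj
      · simpa only [if_pos hj] using a2 j hj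
      · simpa only [if_pos hj] using e1 j hj
      · simpa only [if_pos hj] using e2 j hj
      · simpa only [if_pos hj, if_pos hl] using e3 j hj l hl
    · simp only [W, S]
    · simp only [D, S]
  have hzero : ((fun _ => 0, fun _ => 0, fun _ => 0, fun _ => 0) : RateTuple) ∈ G := by
    change GoodTuple k1 k2 h1 h2 p1 p2 A1 A2 _ _ _ _
    simp [GoodTuple, FeasiblePower, hA1.le, hA2.le]
  obtain ⟨z0, hz0, -⟩ := trunc _ hzero
  obtain ⟨zm, hzm, hmax⟩ := hK.exists_isMaxOn ⟨z0, hz0⟩ hW.continuousOn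
  have hK' : IsCompact (K ∩ {z | W z = W zm}) :=
    hK.inter_right (isClosed_eq hW continuous_const)
  obtain ⟨z, hz, hmin⟩ := hK'.exists_isMinOn ⟨zm, hzm, rfl⟩ hD.continuousOn
  have hzW : W z = W zm := hz.2
  refine ⟨z.1, z.2.1, z.2.2.1, z.2.2.2, hz.1.2, ?_⟩
  intro Q1 Q2 s1 s2 hQ
  obtain ⟨z', hz', eW, eD⟩ := trunc (Q1, Q2, s1, s2) hQ
  constructor
  · change W (Q1, Q2, s1, s2) ≤ W z
    rw [← eW, hzW]
    exact hmax hz'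
  · intro heq
    change W (Q1, Q2, s1, s2) = W z at heq
    change D z ≤ D (Q1, Q2, s1, s2)
    rw [← eD]
    exact hmin ⟨hz', by change W z' = W zm; rw [eW, heq, hzW]⟩

theorem exists_monotone_optimal_power_allocation
    (k1 k2 : ℕ) (hk1 : 1 ≤ k1) (hk2 : 1 ≤ k2)
    (h1 h2 p1 p2 : ℕ → ℝ)
    (hh1pos : ∀ j < k1, 0 < h1 j)
    (hh1mono : ∀ i j, i < j → j < k1 → h1 i < h1 j)
    (hh2pos : ∀ j < k2, 0 < h2 j)
    (hh2mono : ∀ i j, i < j → j < k2 → h2 i < h2 j)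
    (hp1pos : ∀ j < k1, 0 < p1 j)
    (hp1sum : ∑ j ∈ Finset.range k1, p1 j = 1)
    (hp2pos : ∀ j < k2, 0 < p2 j)
    (hp2sum : ∑ j ∈ Finset.range k2, p2 j = 1)
    (Pav1 Pav2 : ℝ) (hPav1 : 0 < Pav1) (hPav2 : 0 < Pav2)
    (α : ℝ) (hα : α ∈ Set.Icc (0:ℝ) 1) :
    ∃ P1 P2 : ℕ → ℝ,
      FeasiblePower k1 p1 Pav1 P1 ∧ FeasiblePower k2 p2 Pav2 P2 ∧
      (∀ Q1 Q2 : ℕ → ℝ, FeasiblePower k1 p1 Pav1 Q1 → FeasiblePower k2 p2 Pav2 Q2 →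
        weightedAdaptiveSumCapacity k1 k2 h1 h2 p1 p2 α Q1 Q2 ≤
          weightedAdaptiveSumCapacity k1 k2 h1 h2 p1 p2 α P1 P2) ∧
      (∀ i j, i ≤ j → j < k1 → (h1 i)^2 * P1 i ≤ (h1 j)^2 * P1 j) ∧
      (∀ i j, i ≤ j → j < k2 → (h2 i)^2 * P2 i ≤ (h2 j)^2 * P2 j) := by
  have conv : ∀ Q1 Q2 s1 s2 : ℕ → ℝ, FeasiblePower k1 p1 Pav1 Q1 → FeasiblePower k2 p2 Pav2 Q2 →
      (GoodTuple k1 k2 h1 h2 p1 p2 Pav1 Pav2 Q1 Q2 s1 s2 ↔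
        ((∀ j < k1, 0 ≤ s1 j) ∧ (∀ k < k2, 0 ≤ s2 k) ∧
        (∀ j < k1, s1 j ≤ (1/2) * Real.log (1 + (h1 j)^2 * Q1 j)) ∧
        (∀ k < k2, s2 k ≤ (1/2) * Real.log (1 + (h2 k)^2 * Q2 k)) ∧
        (∀ j < k1, ∀ k < k2,
          s1 j + s2 k ≤ (1/2) * Real.log (1 + (h1 j)^2 * Q1 j + (h2 k)^2 * Q2 k)))) := by
    intro Q1 Q2 s1 s2 f1 f2
    have n1 : ∀ j < k1, 0 ≤ (h1 j)^2 * Q1 j := fun j hj => mul_nonneg (sq_nonneg _) (f1.1 j hj)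
    have n2 : ∀ j < k2, 0 ≤ (h2 j)^2 * Q2 j := fun j hj => mul_nonneg (sq_nonneg _) (f2.1 j hj)
    constructor
    · rintro ⟨-, -, a1, a2, e1, e2, e3⟩
      refine ⟨a1, a2, fun j hj => ?_, fun j hj => ?_, fun j hj l hl => ?_⟩
      · have := n1 j hj
        rw [le_half_log_iff _ _ (by linarith)]; exact e1 j hj
      · have := n2 j hj
        rw [le_half_log_iff _ _ (by linarith)]; exact e2 j hj
      · have := n1 j hj
        have := n2 l hl
        rw [le_half_log_iff _ _ (by linarith)]; exact e3 j hj l hl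
    · rintro ⟨a1, a2, e1, e2, e3⟩
      refine ⟨f1, f2, a1, a2, fun j hj => ?_, fun j hj => ?_, fun j hj l hl => ?_⟩
      · have := n1 j hj
        rw [← le_half_log_iff _ _ (by linarith)]; exact e1 j hj
      · have := n2 j hj
        rw [← le_half_log_iff _ _ (by linarith)]; exact e2 j hj
      · have := n1 j hj
        have := n2 l hl
        rw [← le_half_log_iff _ _ (by linarith)]; exact e3 j hj l hl
  obtain ⟨P1, P2, r1, r2, hgood, hopt⟩ :=
    exists_lex_optimum k1 k2 h1 h2 p1 p2 Pav1 Pav2 α hPav1 hPav2 hp1pos hp2pos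
  obtain ⟨f1, f2, a1, a2, e1, e2, e3⟩ := id hgood
  have upper : ∀ Q1 Q2 : ℕ → ℝ, FeasiblePower k1 p1 Pav1 Q1 → FeasiblePower k2 p2 Pav2 Q2 →
      ∀ s1 s2 : ℕ → ℝ, ((∀ j < k1, 0 ≤ s1 j) ∧ (∀ k < k2, 0 ≤ s2 k) ∧
        (∀ j < k1, s1 j ≤ (1/2) * Real.log (1 + (h1 j)^2 * Q1 j)) ∧
        (∀ k < k2, s2 k ≤ (1/2) * Real.log (1 + (h2 k)^2 * Q2 k)) ∧
        (∀ j < k1, ∀ k < k2,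
          s1 j + s2 k ≤ (1/2) * Real.log (1 + (h1 j)^2 * Q1 j + (h2 k)^2 * Q2 k))) →
      ∑ j ∈ Finset.range k1, p1 j * s1 j + α * ∑ j ∈ Finset.range k2, p2 j * s2 j ≤
          ∑ j ∈ Finset.range k1, p1 j * r1 j + α * ∑ j ∈ Finset.range k2, p2 j * r2 j :=
    fun Q1 Q2 g1 g2 s1 s2 hs => (hopt Q1 Q2 s1 s2 ((conv Q1 Q2 s1 s2 g1 g2).2 hs)).1
  refine ⟨P1, P2, f1, f2, ?_, ?_, ?_⟩
  · intro Q1 Q2 g1 g2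
    refine le_trans (b := ∑ j ∈ Finset.range k1, p1 j * r1 j
      + α * ∑ j ∈ Finset.range k2, p2 j * r2 j) ?_ ?_
    · apply csSup_le
      · have n1 : ∀ j < k1, 0 ≤ (h1 j)^2 * Q1 j :=
          fun j hj => mul_nonneg (sq_nonneg _) (g1.1 j hj)
        have n2 : ∀ j < k2, 0 ≤ (h2 j)^2 * Q2 j :=
          fun j hj => mul_nonneg (sq_nonneg _) (g2.1 j hj)
        refine ⟨_, fun _ => 0, fun _ => 0, fun _ _ => le_rfl, fun _ _ => le_rfl,
          fun j hj => ?_, fun j hj => ?_, fun j hj l hl => ?_, rfl⟩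
        · have := n1 j hj
          exact mul_nonneg (by norm_num) (Real.log_nonneg (by linarith))
        · have := n2 j hj
          exact mul_nonneg (by norm_num) (Real.log_nonneg (by linarith))
        · have := n1 j hj
          have := n2 l hl
          rw [add_zero]
          exact mul_nonneg (by norm_num) (Real.log_nonneg (by linarith))
      · rintro v ⟨s1, s2, b1, b2, b3, b4, b5, rfl⟩
        exact upper Q1 Q2 g1 g2 s1 s2 ⟨b1, b2, b3, b4, b5⟩
    · apply le_csSup
      · refine ⟨∑ j ∈ Finset.range k1, p1 j * r1 j
          + α * ∑ j ∈ Finset.range k2, p2 j * r2 j, ?_⟩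
        rintro v ⟨s1, s2, b1, b2, b3, b4, b5, rfl⟩
        exact upper P1 P2 f1 f2 s1 s2 ⟨b1, b2, b3, b4, b5⟩
      · obtain ⟨b1, b2, b3, b4, b5⟩ := (conv P1 P2 r1 r2 f1 f2).1 hgood
        exact ⟨r1, r2, b1, b2, b3, b4, b5, rfl⟩
  · intro i j hij hj
    rcases hij.eq_or_lt with rfl | hij
    · exact le_rfl
    by_contra hbad
    push Not at hbad
    obtain ⟨P', r', c1, c2, c3, c4, c5⟩ := averaging_step k1 h1 p1 P1 r1 hh1pos hh1mono hp1pos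
      f1.1 a1 i j hij hj hbad
    have hg : GoodTuple k1 k2 h1 h2 p1 p2 Pav1 Pav2 P' P2 r' r2 := by
      refine ⟨⟨c1, c3.le.trans f1.2⟩, f2, c2, a2, fun l hl => ?_, e2, fun l hl q hq => ?_⟩
      · simpa using c5 0 0 (by simpa using e1) l hl
      · exact c5 _ _ (fun l hl => e3 l hl q hq) l hl
    have := (hopt _ _ _ _ hg).2 (by rw [c4])
    linarith
  · intro i j hij hj
    rcases hij.eq_or_lt with rfl | hij
    · exact le_rfl
    by_contra hbad
    push Not at hbad
    obtain ⟨P', r', c1, c2, c3, c4, c5⟩ := averaging_step k2 h2 p2 P2 r2 hh2pos hh2mono hp2pos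
      f2.1 a2 i j hij hj hbad
    have hg : GoodTuple k1 k2 h1 h2 p1 p2 Pav1 Pav2 P1 P' r1 r' := by
      refine ⟨f1, ⟨c1, c3.le.trans f2.2⟩, a1, c2, e1, fun l hl => ?_, fun q hq l hl => ?_⟩
      · simpa using c5 0 0 (by simpa using e2) l hl
      · have := c5 ((h1 q)^2 * P1 q) (r1 q) (fun l hl => by
          have := e3 q hq l hl
          rw [add_comm (r2 l)]; linarith) l hl
        rw [add_comm (r1 q)]; linarith
    have := (hopt _ _ _ _ hg).2 (by rw [c4])
    linarith
end
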